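/- arXiv:math/0302271 — 4 statements merged into one kernel-verified Lean document; each statement's English description precedes it below -/
import Mathlib

section
/- Let 1/2 < p < 1. The excited random walk on Z with parameter p, started at 0, returns to 0 with probability 1; in particular it is recurrent. -/
open MeasureTheory
open scoped Classical

noncomputable section

/-- Step distribution of the excited random walk on `ℤ` with parameter `p`:
on a first visit (`first` holds) step `+1` with probability `p` and `-1` with
probability `1 - p`; on subsequent visits step `±1` with probability `1/2` each. -/
def erw1StepProb (p : ℝ) (first : Prop) (s : ℤ) : ℝ :=
  if s = 1 then (if first then p else 1 / 2)
  else if s = -1 then (if first then 1 - p else 1 / 2)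
  else 0

/-- `X` is an excited random walk on `ℤ` with parameter `p`, started at `0`,
under the probability measure `P`: conditionally on any initial history, the next
step has the distribution `erw1StepProb`, where "first visit" means that the
current position was not visited at any earlier time. -/
structure IsERW1 (p : ℝ) {Ω : Type*} [MeasurableSpace Ω]
    (P : Measure Ω) (X : ℕ → Ω → ℤ) : Prop where
  isProb : IsProbabilityMeasure P
  meas : ∀ n, Measurable (X n)
  start : ∀ᵐ ω ∂P, X 0 ω = 0
  step : ∀ (n : ℕ) (h : ℕ → ℤ) (s : ℤ),
    P ({ω | X (n + 1) ω = h n + s} ∩ {ω | ∀ k ≤ n, X k ω = h k}) =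
      ENNReal.ofReal (erw1StepProb p (∀ k < n, h k ≠ h n) s) *
        P {ω | ∀ k ≤ n, X k ω = h k}

/-- The first `n` steps of the path `h` start at `0` and have size one. -/
def IsStepPath (n : ℕ) (h : ℕ → ℤ) : Prop :=
  h 0 = 0 ∧ ∀ k < n, h (k + 1) = h k + 1 ∨ h (k + 1) = h k - 1

/-- The largest nonnegative value of the path `h` strictly before time `n`. -/
def pastMax (h : ℕ → ℤ) (n : ℕ) : ℕ :=
  (Finset.range n).sup fun k => (h k).toNat

/-- The slope of the potential of the walk when `{0, …, M}` has already been visited. -/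
def erwSlope (p : ℝ) : ℕ → ℝ
  | 0 => 1
  | M + 1 => erwSlope p M * (M + 1) / (M + 2 * p)

/-- A nonnegative function of the path, superharmonic for the excited random walk
and vanishing from the first return to `0` on. -/
def erwPotential (p : ℝ) (n : ℕ) (h : ℕ → ℤ) : ℝ :=
  if n = 0 then 1
  else if ∃ k, 1 ≤ k ∧ k ≤ n ∧ h k = 0 then 0
  else if 0 < h n then h n * erwSlope p (pastMax h n)
  else -h n

theorem pastMax_congr {h h' : ℕ → ℤ} {n : ℕ} (H : ∀ k < n, h k = h' k) :
    pastMax h n = pastMax h' n :=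
  Finset.sup_congr rfl fun k hk => by rw [H k (Finset.mem_range.1 hk)]

theorem pastMax_succ (h : ℕ → ℤ) (n : ℕ) :
    pastMax h (n + 1) = max (h n).toNat (pastMax h n) := by
  simp [pastMax, Finset.range_add_one]

theorem pastMax_mono (h : ℕ → ℤ) : Monotone (pastMax h) :=
  monotone_nat_of_le_succ fun n => by simp [pastMax_succ]

theorem le_pastMax {h : ℕ → ℤ} {k n : ℕ} (hk : k < n) : h k ≤ pastMax h n := by
  have : (h k).toNat ≤ pastMax h n :=
    Finset.le_sup (f := fun k => (h k).toNat) (Finset.mem_range.2 hk)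
  omega

theorem exists_eq_pastMax {h : ℕ → ℤ} {n : ℕ} (hM : 0 < pastMax h n) :
    ∃ k < n, h k = pastMax h n := by
  have hn : (Finset.range n).Nonempty := by
    rw [Finset.nonempty_range_iff]
    rintro rfl
    simp [pastMax] at hM
  obtain ⟨k, hk, hk'⟩ := Finset.exists_mem_eq_sup _ hn fun k => (h k).toNat
  refine ⟨k, Finset.mem_range.1 hk, ?_⟩
  change pastMax h n = _ at hk'
  omega

theorem IsStepPath.mono {n m : ℕ} {h : ℕ → ℤ} (hh : IsStepPath n h) (hmn : m ≤ n) :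
    IsStepPath m h :=
  ⟨hh.1, fun k hk => hh.2 k (hk.trans_le hmn)⟩

theorem IsStepPath.exists_eq {n : ℕ} {h : ℕ → ℤ} (hh : IsStepPath n h) {y : ℤ}
    (hy : 0 ≤ y) (hyn : y ≤ h n) : ∃ j ≤ n, h j = y := by
  induction n with
  | zero => exact ⟨0, le_rfl, by have := hh.1; omega⟩
  | succ n ih =>
    rcases hyn.eq_or_lt with rfl | hlt
    · exact ⟨n + 1, le_rfl, rfl⟩
    · have hs := hh.2 n n.lt_succ_self
      obtain ⟨j, hj, hj'⟩ := ih (hh.mono n.le_succ) (by omega)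
      exact ⟨j, by omega, hj'⟩

theorem erwSlope_pos {p : ℝ} (hp : 1 / 2 < p) (M : ℕ) : 0 < erwSlope p M := by
  induction M with
  | zero => simp [erwSlope]
  | succ M ih => rw [erwSlope]; positivity

theorem erwSlope_succ_mul {p : ℝ} (hp : 1 / 2 < p) (M : ℕ) :
    erwSlope p (M + 1) * (M + 2 * p) = erwSlope p M * (M + 1) := by
  have : (0 : ℝ) < M + 2 * p := by positivity
  rw [erwSlope]
  field_simp

theorem erwSlope_antitone {p : ℝ} (hp : 1 / 2 < p) : Antitone (erwSlope p) :=
  antitone_nat_of_succ_le fun M => by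
    have h1 := erwSlope_succ_mul hp M
    have h2 := erwSlope_pos hp (M + 1)
    have h3 : (0 : ℝ) < M + 1 := by positivity
    by_contra! h4
    nlinarith

theorem le_succ_mul_erwSlope {p : ℝ} (hp : 1 / 2 < p) (hp1 : p < 1) (M : ℕ) :
    1 + (1 - p) * ∑ i ∈ Finset.range M, (1 : ℝ) / (i + 1) ≤ (M + 1) * erwSlope p M := by
  induction M with
  | zero => simp [erwSlope]
  | succ M ih =>
    have h1 := erwSlope_succ_mul hp M
    have hs : 0 ≤ ∑ i ∈ Finset.range M, (1 : ℝ) / (i + 1) :=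
      Finset.sum_nonneg fun i _ => by positivity
    have hM : (0 : ℝ) ≤ M := by positivity
    have hM1 : (0 : ℝ) < M + 1 := by positivity
    have h2 : 1 ≤ erwSlope p (M + 1) * (M + 2 * p) := by
      rw [h1]
      nlinarith
    have h3 : 1 / ((M : ℝ) + 1) ≤ 2 * erwSlope p (M + 1) := by
      have := erwSlope_pos hp (M + 1)
      rw [div_le_iff₀ hM1]
      nlinarith
    rw [Finset.sum_range_succ]
    push_cast
    nlinarith

theorem tendsto_succ_mul_erwSlope {p : ℝ} (hp : 1 / 2 < p) (hp1 : p < 1) :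
    Filter.Tendsto (fun M : ℕ => ((M : ℝ) + 1) * erwSlope p M) Filter.atTop Filter.atTop :=
  Filter.tendsto_atTop_mono (le_succ_mul_erwSlope hp hp1) <|
    Filter.tendsto_atTop_add_const_left _ _ <|
      Real.tendsto_sum_range_one_div_nat_succ_atTop.const_mul_atTop (by linarith)

theorem erwPotential_congr (p : ℝ) {n : ℕ} {h h' : ℕ → ℤ} (H : ∀ k ≤ n, h k = h' k) :
    erwPotential p n h = erwPotential p n h' := by
  have h1 : (∃ k, 1 ≤ k ∧ k ≤ n ∧ h k = 0) ↔ ∃ k, 1 ≤ k ∧ k ≤ n ∧ h' k = 0 :=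
    exists_congr fun k => and_congr_right fun _ => and_congr_right fun hk => by rw [H k hk]
  simp only [erwPotential, h1, H n le_rfl, pastMax_congr fun k hk => H k hk.le]

theorem erwPotential_nonneg {p : ℝ} (hp : 1 / 2 < p) (n : ℕ) (h : ℕ → ℤ) :
    0 ≤ erwPotential p n h := by
  rw [erwPotential]
  split_ifs with h1 h2 h3
  · exact zero_le_one
  · exact le_rfl
  · exact mul_nonneg (by exact_mod_cast h3.le) (erwSlope_pos hp _).le
  · have : (h n : ℝ) ≤ 0 := by exact_mod_cast not_lt.1 h3
    linarith

theorem erwPotential_succ_le_of_nonneg {p : ℝ} (hp : 1 / 2 < p) {n : ℕ} {h : ℕ → ℤ}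
    (hn : 0 ≤ h (n + 1)) :
    erwPotential p (n + 1) h ≤ h (n + 1) * erwSlope p (pastMax h (n + 1)) := by
  have h0 : 0 ≤ (h (n + 1) : ℝ) * erwSlope p (pastMax h (n + 1)) :=
    mul_nonneg (by exact_mod_cast hn) (erwSlope_pos hp _).le
  rw [erwPotential, if_neg n.succ_ne_zero]
  split_ifs with h2 h3
  · exact h0
  · exact le_rfl
  · exact absurd ⟨n + 1, by omega, le_rfl, by omega⟩ h2

theorem erwPotential_succ_le_of_nonpos (p : ℝ) {n : ℕ} {h : ℕ → ℤ} (hn : h (n + 1) ≤ 0) :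
    erwPotential p (n + 1) h ≤ -h (n + 1) := by
  rw [erwPotential, if_neg n.succ_ne_zero]
  split_ifs with h2 h3
  · have : (h (n + 1) : ℝ) ≤ 0 := by exact_mod_cast hn
    linarith
  · omega
  · exact le_rfl

theorem erwPotential_superharmonic {p : ℝ} (hp : 1 / 2 < p) (hp1 : p < 1) {n : ℕ} {h : ℕ → ℤ}
    (hh : IsStepPath n h) :
    erw1StepProb p (∀ k < n, h k ≠ h n) 1 *
        erwPotential p (n + 1) (Function.update h (n + 1) (h n + 1)) +
      erw1StepProb p (∀ k < n, h k ≠ h n) (-1) *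
        erwPotential p (n + 1) (Function.update h (n + 1) (h n + -1)) ≤
    erwPotential p n h := by
  have hmax (y : ℤ) : pastMax (Function.update h (n + 1) y) (n + 1) = pastMax h (n + 1) :=
    pastMax_congr fun k hk => Function.update_of_ne hk.ne _ _
  have hpos (y : ℤ) (hy : 0 ≤ y) : erwPotential p (n + 1) (Function.update h (n + 1) y) ≤
      y * erwSlope p (pastMax h (n + 1)) := by
    have := erwPotential_succ_le_of_nonneg hp (n := n) (h := Function.update h (n + 1) y)
      (by simpa using hy)
    rwa [hmax, Function.update_self] at this
  have hneg (y : ℤ) (hy : y ≤ 0) :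
      erwPotential p (n + 1) (Function.update h (n + 1) y) ≤ -y := by
    have := erwPotential_succ_le_of_nonpos p (n := n) (h := Function.update h (n + 1) y)
      (by simpa using hy)
    rwa [Function.update_self] at this
  simp only [erw1StepProb, if_true, show (-1 : ℤ) ≠ 1 by decide, if_false]
  rcases Nat.eq_zero_or_pos n with rfl | hn
  · have h0 := hh.1
    have h1 := hpos (h 0 + 1) (by omega)
    have h2 := hneg (h 0 + -1) (by omega)
    simp only [h0, pastMax_succ] at h1 h2 ⊢
    norm_num [pastMax, erwSlope] at h1 h2 ⊢
    rw [show erwPotential p 0 h = 1 by simp [erwPotential]]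
    nlinarith
  by_cases hret : ∃ k, 1 ≤ k ∧ k ≤ n ∧ h k = 0
  · obtain ⟨k, hk1, hkn, hk⟩ := hret
    have hz (y : ℤ) : erwPotential p (n + 1) (Function.update h (n + 1) y) = 0 := by
      rw [erwPotential, if_neg (by omega), if_pos]
      exact ⟨k, hk1, by omega, by rwa [Function.update_of_ne (by omega)]⟩
    rw [hz, hz, mul_zero, mul_zero, add_zero]
    exact erwPotential_nonneg hp n h
  have hn0 : h n ≠ 0 := fun h0 => hret ⟨n, hn, le_rfl, h0⟩
  rw [show erwPotential p n h = if 0 < h n then h n * erwSlope p (pastMax h n) else -h n by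
    rw [erwPotential, if_neg hn.ne', if_neg hret]]
  rcases lt_or_gt_of_ne hn0 with hlt | hgt
  · have h1 := hneg (h n + 1) (by omega)
    have h2 := hneg (h n + -1) (by omega)
    rw [if_neg hlt.not_gt]
    push_cast at h1 h2
    by_cases hf : ∀ k < n, h k ≠ h n
    · rw [if_pos hf, if_pos hf]
      nlinarith
    · rw [if_neg hf, if_neg hf]
      linarith
  · have h1 := hpos (h n + 1) (by omega)
    have h2 := hpos (h n + -1) (by omega)
    rw [if_pos hgt]
    push_cast at h1 h2
    rcases le_or_gt (h n) (pastMax h n) with hle | hlt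
    · obtain ⟨k, hkn, hk⟩ := exists_eq_pastMax (h := h) (n := n) (by omega)
      obtain ⟨j, hj, hj'⟩ := (hh.mono hkn.le).exists_eq (y := h n) hgt.le (by omega)
      have hnf : ¬ ∀ k < n, h k ≠ h n := fun H => H j (by omega) hj'
      rw [if_neg hnf, if_neg hnf]
      rw [show pastMax h (n + 1) = pastMax h n by rw [pastMax_succ]; omega] at h1 h2
      linarith
    · have hf : ∀ k < n, h k ≠ h n := fun k hk => by
        have := le_pastMax (h := h) hk
        omega
      have hn' : h n = pastMax h n + 1 := by
        obtain ⟨m, rfl⟩ : ∃ m, n = m + 1 := ⟨n - 1, by omega⟩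
        have := le_pastMax (h := h) m.lt_succ_self
        have := hh.2 m m.lt_succ_self
        simp only [Nat.succ_eq_add_one] at *
        omega
      rw [if_pos hf, if_pos hf]
      rw [show pastMax h (n + 1) = pastMax h n + 1 by rw [pastMax_succ]; omega] at h1 h2
      have hs := erwSlope_succ_mul hp (pastMax h n)
      have hn'' : (h n : ℝ) = pastMax h n + 1 := by exact_mod_cast hn'
      rw [hn''] at h1 h2 ⊢
      have h3 := mul_le_mul_of_nonneg_left h1 (by linarith : 0 ≤ p)
      have h4 := mul_le_mul_of_nonneg_left h2 (by linarith : 0 ≤ 1 - p)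
      linarith

theorem not_tendsto_of_const_abs_sub {u : ℕ → ℝ} {d c : ℝ} (hd : 0 < d) {N : ℕ}
    (hu : ∀ n ≥ N, |u (n + 1) - u n| = d) : ¬ Filter.Tendsto u Filter.atTop (nhds c) := by
  intro hc
  have h1 : Filter.Tendsto (fun n => |u (n + 1) - u n|) Filter.atTop (nhds |c - c|) :=
    (((Filter.tendsto_add_atTop_iff_nat 1).2 hc).sub hc).abs
  have h2 : Filter.Tendsto (fun n => |u (n + 1) - u n|) Filter.atTop (nhds d) :=
    tendsto_const_nhds.congr' <| Filter.eventually_atTop.2 ⟨N, fun n hn => (hu n hn).symm⟩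
  have := tendsto_nhds_unique h1 h2
  simp at this
  linarith

/-- Along a nearest-neighbor path that never returns to `0`, the potential does not converge. -/
theorem not_tendsto_erwPotential {p : ℝ} (hp : 1 / 2 < p) (hp1 : p < 1) {h : ℕ → ℤ}
    (hh : ∀ n, IsStepPath n h) (hret : ∀ n, 1 ≤ n → h n ≠ 0) (c : ℝ) :
    ¬ Filter.Tendsto (fun n => erwPotential p n h) Filter.atTop (nhds c) := by
  have hstep (n : ℕ) : h (n + 1) = h n + 1 ∨ h (n + 1) = h n - 1 :=
    (hh (n + 1)).2 n n.lt_succ_self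
  have hpot (n : ℕ) (hn : 1 ≤ n) : erwPotential p n h =
      if 0 < h n then h n * erwSlope p (pastMax h n) else -h n := by
    rw [erwPotential, if_neg (by omega), if_neg]
    rintro ⟨k, hk1, -, hk⟩
    exact hret k hk1 hk
  rcases lt_or_gt_of_ne (hret 1 le_rfl) with h1 | h1
  · have hneg (n : ℕ) (hn : 1 ≤ n) : h n < 0 := by
      induction n, hn using Nat.le_induction with
      | base => exact h1
      | succ n hn ih =>
        have := hret (n + 1) (by omega)
        have := hstep n
        omega
    refine not_tendsto_of_const_abs_sub one_pos (N := 1) fun n hn => ?_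
    rw [hpot n hn, hpot (n + 1) (by omega), if_neg (hneg n hn).not_gt,
      if_neg (hneg (n + 1) (by omega)).not_gt]
    rcases hstep n with h2 | h2 <;> rw [h2] <;> push_cast
    · rw [show -((h n : ℝ) + 1) - -h n = -1 by ring]; simp
    · rw [show -((h n : ℝ) - 1) - -h n = 1 by ring]; simp
  have hpos (n : ℕ) (hn : 1 ≤ n) : 0 < h n := by
    induction n, hn using Nat.le_induction with
    | base => exact h1
    | succ n hn ih =>
      have := hret (n + 1) (by omega)
      have := hstep n
      omega
  have hpot' (n : ℕ) (hn : 1 ≤ n) :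
      erwPotential p n h = h n * erwSlope p (pastMax h n) := by
    rw [hpot n hn, if_pos (hpos n hn)]
  rcases tendsto_atTop_of_monotone (pastMax_mono h) with hM | ⟨M, hM⟩
  · intro hc
    obtain ⟨C, hC⟩ := hc.bddAbove_range
    obtain ⟨K, hK⟩ := ((tendsto_succ_mul_erwSlope hp hp1).eventually_gt_atTop C).exists
    obtain ⟨n, hn⟩ := (hM.eventually_ge_atTop (K + 1)).exists
    obtain ⟨k, -, hk⟩ := exists_eq_pastMax (h := h) (n := n) (by omega)
    have hex : ∃ j, h j = K + 1 := by
      obtain ⟨j, -, hj⟩ := (hh k).exists_eq (y := K + 1) (by omega) (by omega)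
      exact ⟨j, hj⟩
    have hj := Nat.find_spec hex
    have hmin {i : ℕ} (hi : i < Nat.find hex) : h i ≠ K + 1 := Nat.find_min hex hi
    set j := Nat.find hex
    have hj1 : 1 ≤ j := by
      by_contra! hj0
      rw [Nat.lt_one_iff.1 hj0, (hh 0).1] at hj
      omega
    have hjmax : pastMax h j ≤ K := by
      refine Finset.sup_le fun i hi => ?_
      by_contra! hlt
      obtain ⟨l, hl, hl'⟩ := (hh i).exists_eq (y := K + 1) (by omega) (by omega)
      exact hmin (hl.trans_lt (Finset.mem_range.1 hi)) hl'
    have hle : ((K : ℝ) + 1) * erwSlope p K ≤ erwPotential p j h := by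
      rw [hpot' j hj1, hj]
      push_cast
      exact mul_le_mul_of_nonneg_left (erwSlope_antitone hp hjmax) (by positivity)
    exact absurd (hC ⟨j, rfl⟩) (not_le.2 (hK.trans_le hle))
  · rw [nhds_discrete, Filter.tendsto_pure] at hM
    obtain ⟨N, hN⟩ := Filter.eventually_atTop.1 hM
    refine not_tendsto_of_const_abs_sub (erwSlope_pos hp M) (N := N + 1) fun n hn => ?_
    rw [hpot' n (by omega), hpot' (n + 1) (by omega), hN n (by omega), hN (n + 1) (by omega),
      ← sub_mul, abs_mul, abs_of_pos (erwSlope_pos hp M)]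
    rcases hstep n with h2 | h2 <;> rw [h2] <;> simp

section Probability

variable {Ω : Type*} {X : ℕ → Ω → ℤ}

/-- The positions at the times `0, …, n`. -/
def pathHistory (X : ℕ → Ω → ℤ) (n : ℕ) (ω : Ω) : Fin (n + 1) → ℤ := fun k => X k ω

/-- The path which follows `b` up to time `n` and then stays constant. -/
def extendHistory {n : ℕ} (b : Fin (n + 1) → ℤ) (k : ℕ) : ℤ :=
  b ⟨min k n, by omega⟩

theorem extendHistory_pathHistory (n : ℕ) (ω : Ω) {k : ℕ} (hk : k ≤ n) :
    extendHistory (pathHistory X n ω) k = X k ω := by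
  simp [extendHistory, pathHistory, hk]

theorem pathHistory_eq_iff {n : ℕ} {b : Fin (n + 1) → ℤ} {ω : Ω} :
    pathHistory X n ω = b ↔ ∀ k ≤ n, X k ω = extendHistory b k := by
  constructor
  · rintro rfl k hk
    exact (extendHistory_pathHistory n ω hk).symm
  · intro H
    ext k
    have hk : (k : ℕ) ≤ n := by omega
    simpa [extendHistory, pathHistory, hk] using H k hk

variable {p : ℝ} [MeasurableSpace Ω] {P : Measure Ω}

theorem measurable_pathHistory (hX : ∀ n, Measurable (X n)) (n : ℕ) :
    Measurable (pathHistory X n) :=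
  measurable_pi_iff.2 fun k => hX k

/-- The filtration generated by the history of the process. -/
def historyFiltration (hX : ∀ n, Measurable (X n)) :
    Filtration ℕ (inferInstance : MeasurableSpace Ω) where
  seq n := MeasurableSpace.comap (pathHistory X n) inferInstance
  mono' n m hnm := by
    have : pathHistory X n =
        (fun b : Fin (m + 1) → ℤ => fun k : Fin (n + 1) => b ⟨k, by omega⟩) ∘
          pathHistory X m := rfl
    beta_reduce
    rw [this, ← MeasurableSpace.comap_comp]
    exact MeasurableSpace.comap_mono
      (measurable_pi_iff.2 fun k => measurable_pi_apply _).comap_le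
  le' n := (measurable_pathHistory hX n).comap_le

theorem measurableSet_cylinder (hX : ∀ n, Measurable (X n)) (n : ℕ) (h : ℕ → ℤ) :
    MeasurableSet {ω | ∀ k ≤ n, X k ω = h k} := by
  have : {ω | ∀ k ≤ n, X k ω = h k} = ⋂ k, ⋂ _ : k ≤ n, X k ⁻¹' {h k} := by
    ext; simp
  rw [this]
  exact .iInter fun k => .iInter fun _ => hX k (.singleton _)

theorem IsERW1.ae_isStepPath (hX : IsERW1 p P X) :
    ∀ᵐ ω ∂P, ∀ n, IsStepPath n fun k => X k ω := by
  have key : ∀ᵐ ω ∂P, ∀ n, ∀ b : Fin (n + 1) → ℤ, ∀ s : ℤ, s ≠ 1 → s ≠ -1 →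
      ¬ (X (n + 1) ω = extendHistory b n + s ∧ ∀ k ≤ n, X k ω = extendHistory b k) := by
    simp only [ae_all_iff]
    intro n b s h1 h2
    rw [ae_iff]
    simp only [not_not]
    have := hX.step n (extendHistory b) s
    rw [erw1StepProb, if_neg h1, if_neg h2, ENNReal.ofReal_zero, zero_mul] at this
    exact this
  filter_upwards [key, hX.start] with ω hω h0 n
  refine ⟨h0, fun k _ => ?_⟩
  by_contra! H
  refine hω k (pathHistory X k ω) (X (k + 1) ω - X k ω) (by have := H.1; omega)
    (by have := H.2; omega) ⟨?_, fun j hj => (extendHistory_pathHistory k ω hj).symm⟩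
  rw [extendHistory_pathHistory k ω le_rfl]
  ring

theorem IsERW1.setLIntegral_cylinder_succ_le (hX : IsERW1 p P X) (hp : 1 / 2 < p) (hp1 : p < 1)
    (n : ℕ) (h : ℕ → ℤ) :
    ∫⁻ ω in {ω | ∀ k ≤ n, X k ω = h k},
        ENNReal.ofReal (erwPotential p (n + 1) fun k => X k ω) ∂P ≤
      ∫⁻ ω in {ω | ∀ k ≤ n, X k ω = h k}, ENNReal.ofReal (erwPotential p n fun k => X k ω) ∂P := by
  set C := {ω | ∀ k ≤ n, X k ω = h k} with hC
  have hCm : MeasurableSet C := measurableSet_cylinder hX.meas n h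
  rcases eq_or_ne (P C) 0 with h0 | h0
  · rw [setLIntegral_measure_zero _ _ h0]
    exact zero_le
  have hh : IsStepPath n h := by
    obtain ⟨ω, hωC, hω⟩ : ∃ ω ∈ C, ∀ n, IsStepPath n fun k => X k ω := by
      by_contra! H
      exact h0 (measure_mono_null (fun ω hω => by simpa using H ω hω) hX.ae_isStepPath)
    refine ⟨(hωC 0 n.zero_le).symm.trans (hω 0).1, fun k hk => ?_⟩
    rw [← hωC k hk.le, ← hωC (k + 1) hk]
    exact (hω n).2 k hk
  have hstep (s : ℤ) :
      ∫⁻ ω in {ω | X (n + 1) ω = h n + s} ∩ C,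
          ENNReal.ofReal (erwPotential p (n + 1) fun k => X k ω) ∂P =
        ENNReal.ofReal (erwPotential p (n + 1) (Function.update h (n + 1) (h n + s))) *
          (ENNReal.ofReal (erw1StepProb p (∀ k < n, h k ≠ h n) s) * P C) := by
    have hm : MeasurableSet ({ω | X (n + 1) ω = h n + s} ∩ C) :=
      (hX.meas (n + 1) (.singleton _)).inter hCm
    rw [← hX.step n h s, ← setLIntegral_const]
    refine setLIntegral_congr_fun hm fun ω hω => ?_
    refine congrArg ENNReal.ofReal (erwPotential_congr p fun k hk => ?_)
    rcases hk.eq_or_lt with rfl | hlt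
    · simpa using hω.1
    · rw [Function.update_of_ne hlt.ne]
      exact hω.2 k (by omega)
  have hcover : C ≤ᵐ[P] (({ω | X (n + 1) ω = h n + 1} ∩ C) ∪
      ({ω | X (n + 1) ω = h n + -1} ∩ C) : Set Ω) := by
    filter_upwards [hX.ae_isStepPath] with ω hω hωC
    have hn : X n ω = h n := hωC n le_rfl
    rcases (hω (n + 1)).2 n n.lt_succ_self with h1 | h1
    · exact Or.inl ⟨by simpa [hn] using h1, hωC⟩
    · exact Or.inr ⟨by simpa [hn, sub_eq_add_neg] using h1, hωC⟩
  have hq (s : ℤ) : 0 ≤ erw1StepProb p (∀ k < n, h k ≠ h n) s := by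
    rw [erw1StepProb]
    split_ifs <;> linarith
  have hw (s : ℤ) : 0 ≤ erwPotential p (n + 1) (Function.update h (n + 1) (h n + s)) :=
    erwPotential_nonneg hp _ _
  have hconst : ∫⁻ ω in C, ENNReal.ofReal (erwPotential p n fun k => X k ω) ∂P =
      ENNReal.ofReal (erwPotential p n h) * P C := by
    rw [← setLIntegral_const]
    exact setLIntegral_congr_fun hCm fun ω hω =>
      congrArg ENNReal.ofReal (erwPotential_congr p hω)
  rw [hconst]
  refine (lintegral_mono_set' hcover).trans ((lintegral_union_le _ _ _).trans ?_)
  rw [hstep, hstep, ← mul_assoc, ← mul_assoc, ← add_mul, ← ENNReal.ofReal_mul (hw _),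
    ← ENNReal.ofReal_mul (hw _),
    ← ENNReal.ofReal_add (mul_nonneg (hw _) (hq _)) (mul_nonneg (hw _) (hq _))]
  gcongr
  rw [mul_comm, mul_comm (erwPotential p (n + 1) (Function.update h (n + 1) (h n + -1)))]
  exact erwPotential_superharmonic hp hp1 hh

theorem IsERW1.setLIntegral_succ_le (hX : IsERW1 p P X) (hp : 1 / 2 < p) (hp1 : p < 1)
    (n : ℕ) {S : Set Ω} (hS : MeasurableSet[historyFiltration hX.meas n] S) :
    ∫⁻ ω in S, ENNReal.ofReal (erwPotential p (n + 1) fun k => X k ω) ∂P ≤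
      ∫⁻ ω in S, ENNReal.ofReal (erwPotential p n fun k => X k ω) ∂P := by
  obtain ⟨B, -, rfl⟩ := hS
  have hunion : pathHistory X n ⁻¹' B =
      ⋃ b ∈ B, {ω | ∀ k ≤ n, X k ω = extendHistory b k} := by
    ext ω
    simp [← pathHistory_eq_iff]
  have hdisj : B.PairwiseDisjoint fun b => {ω | ∀ k ≤ n, X k ω = extendHistory b k} := by
    intro b _ b' _ hbb'
    refine Set.disjoint_left.2 fun ω h1 h2 => hbb' ?_
    exact (pathHistory_eq_iff.2 h1).symm.trans (pathHistory_eq_iff.2 h2)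
  have hm (b : Fin (n + 1) → ℤ) (_ : b ∈ B) :=
    measurableSet_cylinder hX.meas n (extendHistory b)
  rw [hunion, lintegral_biUnion B.to_countable hm hdisj, lintegral_biUnion B.to_countable hm hdisj]
  exact ENNReal.tsum_le_tsum fun b => hX.setLIntegral_cylinder_succ_le hp hp1 n _

theorem stronglyAdapted_erwPotential (p : ℝ) (hX : ∀ n, Measurable (X n)) :
    StronglyAdapted (historyFiltration hX) fun n ω => erwPotential p n fun k => X k ω := by
  intro n
  have : (fun ω => erwPotential p n fun k => X k ω) =
      (fun b => erwPotential p n (extendHistory b)) ∘ pathHistory X n := by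
    ext ω
    exact erwPotential_congr p fun k hk => (extendHistory_pathHistory n ω hk).symm
  beta_reduce
  rw [this]
  refine Measurable.stronglyMeasurable ?_
  exact (measurable_of_countable _).comp (comap_measurable (pathHistory X n))

theorem IsERW1.lintegral_erwPotential_le_one (hX : IsERW1 p P X) (hp : 1 / 2 < p) (hp1 : p < 1)
    (n : ℕ) : ∫⁻ ω, ENNReal.ofReal (erwPotential p n fun k => X k ω) ∂P ≤ 1 := by
  have := hX.isProb
  induction n with
  | zero => simp [erwPotential]
  | succ n ih =>
    refine le_trans ?_ ih
    simpa using hX.setLIntegral_succ_le hp hp1 n MeasurableSet.univ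

theorem IsERW1.ae_exists_tendsto_erwPotential (hX : IsERW1 p P X) (hp : 1 / 2 < p) (hp1 : p < 1) :
    ∀ᵐ ω ∂P, ∃ c, Filter.Tendsto (fun n => erwPotential p n fun k => X k ω)
      Filter.atTop (nhds c) := by
  have := hX.isProb
  have hadp := stronglyAdapted_erwPotential p hX.meas
  have hnonneg (n : ℕ) (ω : Ω) : 0 ≤ erwPotential p n fun k => X k ω :=
    erwPotential_nonneg hp _ _
  have hmeas (n : ℕ) : AEStronglyMeasurable (fun ω => erwPotential p n fun k => X k ω) P :=
    ((hadp n).mono ((historyFiltration hX.meas).le n)).aestronglyMeasurable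
  have hint (n : ℕ) : Integrable (fun ω => erwPotential p n fun k => X k ω) P := by
    refine ⟨hmeas n, (hasFiniteIntegral_iff_ofReal (ae_of_all _ (hnonneg n))).2 ?_⟩
    exact (hX.lintegral_erwPotential_le_one hp hp1 n).trans_lt ENNReal.one_lt_top
  have hsuper : Supermartingale (fun n ω => erwPotential p n fun k => X k ω)
      (historyFiltration hX.meas) P := by
    refine supermartingale_of_setIntegral_succ_le hadp hint fun n S hS => ?_
    rw [integral_eq_lintegral_of_nonneg_ae (ae_of_all _ (hnonneg _)) (hmeas _).restrict,
      integral_eq_lintegral_of_nonneg_ae (ae_of_all _ (hnonneg _)) (hmeas _).restrict]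
    refine ENNReal.toReal_mono (ne_of_lt ?_) (hX.setLIntegral_succ_le hp hp1 n hS)
    exact (setLIntegral_le_lintegral _ _).trans_lt
      ((hX.lintegral_erwPotential_le_one hp hp1 n).trans_lt ENNReal.one_lt_top)
  have hbdd (n : ℕ) : eLpNorm ((-fun n ω => erwPotential p n fun k => X k ω) n) 1 P ≤
      (1 : NNReal) := by
    rw [Pi.neg_apply, eLpNorm_neg, eLpNorm_one_eq_lintegral_enorm]
    simp only [Real.enorm_of_nonneg (hnonneg _ _)]
    exact hX.lintegral_erwPotential_le_one hp hp1 n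
  filter_upwards [hsuper.neg.exists_ae_tendsto_of_bdd hbdd] with ω ⟨c, hc⟩
  exact ⟨-c, by simpa using hc.neg⟩

end Probability

/-- **Recurrence of excited random walk on `ℤ`.**
For `1/2 < p < 1`, the excited random walk on `ℤ` with parameter `p`, started
at `0`, returns to `0` with probability `1`. -/
theorem excited_random_walk_Z_recurrent (p : ℝ) (hp : 1 / 2 < p) (hp1 : p < 1)
    {Ω : Type*} [MeasurableSpace Ω] (P : Measure Ω)
    (X : ℕ → Ω → ℤ) (hX : IsERW1 p P X) :
    P {ω | ∃ n, 1 ≤ n ∧ X n ω = 0} = 1 := by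
  have := hX.isProb
  have hae : ∀ᵐ ω ∂P, ∃ n, 1 ≤ n ∧ X n ω = 0 := by
    filter_upwards [hX.ae_isStepPath, hX.ae_exists_tendsto_erwPotential hp hp1]
      with ω hω ⟨c, hc⟩
    by_contra! H
    exact not_tendsto_erwPotential hp hp1 hω H c hc
  rw [← measure_univ (μ := P)]
  exact measure_congr (Filter.eventuallyEq_univ.2 hae)
end
end

section
/- Consider the excited random walk on Z with parameter p (1/2 < p < 1). Suppose that at some time the walker is at a vertex x > 0 for the first time and that all vertices strictly between 0 and x have already been visited. Then the conditional probability that the walker reaches x+1 before reaching 0 equals p + (1−p)(1 − 2/(x+1)) = 1 − 2(1−p)/(x+1). -/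
open MeasureTheory
open scoped Classical

noncomputable section

/-- The mean of `φ` after one step from an interior point `y` of the interval `[0, x + 1]`. -/
theorem sum_mul_erw1StepProb (p : ℝ) (first : Prop) {x y : ℤ} (hy : y ∈ Finset.Icc 1 x)
    (φ : ℤ → ℝ) :
    ∑ z ∈ Finset.Icc 0 (x + 1), φ z * erw1StepProb p first (z - y) =
      erw1StepProb p first 1 * φ (y + 1) + erw1StepProb p first (-1) * φ (y - 1) := by
  rw [Finset.mem_Icc] at hy
  have hsub : ({y + 1, y - 1} : Finset ℤ) ⊆ Finset.Icc 0 (x + 1) := by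
    intro z hz
    simp only [Finset.mem_insert, Finset.mem_singleton] at hz
    rw [Finset.mem_Icc]
    omega
  rw [← Finset.sum_subset hsub, Finset.sum_pair (by omega)]
  · rw [show y + 1 - y = 1 by ring, show y - 1 - y = -1 by ring]
    ring
  · intro z _ hz
    simp only [Finset.mem_insert, Finset.mem_singleton, not_or] at hz
    rw [erw1StepProb, if_neg (by omega), if_neg (by omega), mul_zero]

theorem sum_Icc_eq_add_sum_Icc_interior {x : ℤ} (hx : 0 < x) (f : ℤ → ℝ) :
    ∑ z ∈ Finset.Icc 0 (x + 1), f z = f 0 + f (x + 1) + ∑ z ∈ Finset.Icc 1 x, f z := by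
  have : Finset.Icc 0 (x + 1) = insert 0 (insert (x + 1) (Finset.Icc 1 x)) := by
    ext z
    simp only [Finset.mem_insert, Finset.mem_Icc]
    omega
  rw [this, Finset.sum_insert, Finset.sum_insert, add_assoc]
  · simp
  · simp only [Finset.mem_insert, Finset.mem_Icc]
    omega

/-- One step of the evolution of a simple random walk killed on leaving `[1, x]`, tested
against `φ`. -/
theorem sum_mul_killed_step (p : ℝ) {x : ℤ} (c c' : ℤ → ℝ)
    (hc : ∀ z, c' z = ∑ y ∈ Finset.Icc 1 x, erw1StepProb p False (z - y) * c y) (φ : ℤ → ℝ) :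
    ∑ z ∈ Finset.Icc 0 (x + 1), φ z * c' z =
      ∑ y ∈ Finset.Icc 1 x, (φ (y + 1) + φ (y - 1)) / 2 * c y := by
  simp_rw [hc, Finset.mul_sum]
  rw [Finset.sum_comm]
  refine Finset.sum_congr rfl fun y hy ↦ ?_
  have := sum_mul_erw1StepProb p False hy φ
  simp_rw [← mul_assoc]
  rw [← Finset.sum_mul, this]
  congr 1
  norm_num [erw1StepProb]
  ring

/-- **Gambler's ruin** for the masses `c k z` at time `k` of a simple random walk killed on
leaving `[1, x]`: the total mass leaving through `x + 1` is the initial mean divided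
by `x + 1`. -/
theorem hasSum_killed_exit_right (p : ℝ) {x : ℤ} (hx : 0 < x) (c : ℕ → ℤ → ℝ)
    (hnonneg : ∀ k z, 0 ≤ c k z)
    (hc : ∀ k z, c (k + 1) z = ∑ y ∈ Finset.Icc 1 x, erw1StepProb p False (z - y) * c k y) :
    HasSum (fun k ↦ c k (x + 1))
      ((∑ z ∈ Finset.Icc 0 (x + 1), (z : ℝ) * c 0 z) / ((x : ℝ) + 1)) := by
  have hxR : (0 : ℝ) < x := by exact_mod_cast hx
  set F : ℕ → ℝ := fun k ↦ ∑ y ∈ Finset.Icc 1 x, (y : ℝ) * c k y with hF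
  set T : ℕ → ℝ := fun k ↦ ∑ y ∈ Finset.Icc 1 x, c k y with hT
  set G : ℕ → ℝ := fun k ↦ ∑ y ∈ Finset.Icc 1 x, ((y : ℝ) * (x + 1 - y)) * c k y with hG
  have hT0 : ∀ k, 0 ≤ T k := fun k ↦ Finset.sum_nonneg fun y _ ↦ hnonneg k y
  have hG0 : ∀ k, 0 ≤ G k := by
    intro k
    refine Finset.sum_nonneg fun y hy ↦ mul_nonneg ?_ (hnonneg k y)
    rw [Finset.mem_Icc] at hy
    have h1 : (1 : ℝ) ≤ y := by exact_mod_cast hy.1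
    have h2 : (y : ℝ) ≤ x := by exact_mod_cast hy.2
    exact mul_nonneg (by linarith) (by linarith)
  have hFstep : ∀ k, (x + 1) * c (k + 1) (x + 1) + F (k + 1) = F k := by
    intro k
    have h1 := sum_mul_killed_step p (c k) (c (k + 1)) (hc k) (fun z ↦ (z : ℝ))
    rw [sum_Icc_eq_add_sum_Icc_interior hx] at h1
    push_cast at h1
    rw [zero_mul, zero_add] at h1
    rw [hF]
    refine h1.trans (Finset.sum_congr rfl fun y _ ↦ ?_)
    ring
  have hGstep : ∀ k, G (k + 1) + T k = G k := by
    intro k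
    have h1 := sum_mul_killed_step p (c k) (c (k + 1)) (hc k)
      (fun z ↦ (z : ℝ) * (x + 1 - z))
    rw [sum_Icc_eq_add_sum_Icc_interior hx] at h1
    push_cast at h1
    rw [sub_self, zero_mul, zero_mul, mul_zero, zero_mul, zero_add, zero_add] at h1
    simp only [hG, hT]
    rw [h1, ← Finset.sum_add_distrib]
    refine Finset.sum_congr rfl fun y _ ↦ ?_
    ring
  have hTsum : Summable T := by
    refine summable_of_sum_range_le (c := G 0) hT0 fun K ↦ ?_
    have : ∑ i ∈ Finset.range K, T i + G K = G 0 := by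
      induction K with
      | zero => simp
      | succ K ih => rw [Finset.sum_range_succ]; linarith [hGstep K]
    linarith [hG0 K]
  have hFlim : Filter.Tendsto F Filter.atTop (nhds 0) := by
    have h1 := hTsum.tendsto_atTop_zero.const_mul (x : ℝ)
    rw [mul_zero] at h1
    refine squeeze_zero (fun k ↦ ?_) (fun k ↦ ?_) h1
    · refine Finset.sum_nonneg fun y hy ↦ mul_nonneg ?_ (hnonneg k y)
      rw [Finset.mem_Icc] at hy
      exact_mod_cast (by omega : 0 ≤ y)
    · simp only [hT, hF]
      rw [Finset.mul_sum]
      refine Finset.sum_le_sum fun y hy ↦ mul_le_mul_of_nonneg_right ?_ (hnonneg k y)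
      exact_mod_cast (Finset.mem_Icc.1 hy).2
  rw [hasSum_iff_tendsto_nat_of_nonneg (fun k ↦ hnonneg k _), ← Filter.tendsto_add_atTop_iff_nat 1]
  set M := ∑ z ∈ Finset.Icc 0 (x + 1), (z : ℝ) * c 0 z with hM
  have hM0 : M = (x + 1) * c 0 (x + 1) + F 0 := by
    rw [hM, sum_Icc_eq_add_sum_Icc_interior hx]
    push_cast
    ring
  have hpartial : ∀ K, ∑ i ∈ Finset.range (K + 1), c i (x + 1) = (M - F K) / (x + 1) := by
    intro K
    rw [eq_div_iff (by linarith)]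
    induction K with
    | zero => rw [hM0]; simp; ring
    | succ K ih => rw [Finset.sum_range_succ, add_mul, ih]; linarith [hFstep K]
  simp_rw [hpartial]
  simpa using (hFlim.const_sub M).div_const ((x : ℝ) + 1)

section Walk

variable {p : ℝ} {Ω : Type*} [MeasurableSpace Ω] {P : Measure Ω} {X : ℕ → Ω → ℤ}

/-- Events determined by the path up to time `N` are measurable. -/
theorem IsERW1.measurableSet_history (hX : IsERW1 p P X) (N : ℕ) (Q : (ℕ → ℤ) → Prop)
    (hQ : ∀ f g : ℕ → ℤ, (∀ k ≤ N, f k = g k) → Q f → Q g) :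
    MeasurableSet {ω | Q fun k ↦ X k ω} := by
  have hW : Measurable fun ω (i : Fin (N + 1)) ↦ X i ω :=
    measurable_pi_lambda _ fun i ↦ hX.meas i
  have : {ω | Q fun k ↦ X k ω} = (fun ω (i : Fin (N + 1)) ↦ X i ω) ⁻¹'
      {g | Q fun k ↦ g (Fin.ofNat (N + 1) k)} := by
    ext ω
    have key : ∀ k ≤ N, X k ω = X (Fin.ofNat (N + 1) k : Fin (N + 1)) ω := by
      intro k hk
      rw [Fin.val_ofNat, Nat.mod_eq_of_lt (by omega)]
    exact ⟨hQ _ _ key, hQ _ _ fun k hk ↦ (key k hk).symm⟩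
  rw [this]
  exact hW (Set.to_countable _).measurableSet

/-- The transition rule of the walk, given an event `Q` determined by the path up to time `N`
on which the transition probability is constant. -/
theorem IsERW1.measure_step_inter (hX : IsERW1 p P X) (N : ℕ) (Q : (ℕ → ℤ) → Prop)
    (hQ : ∀ f g : ℕ → ℤ, (∀ k ≤ N, f k = g k) → Q f → Q g) (s : ℤ) (r : ℝ)
    (hr : ∀ f, Q f → erw1StepProb p (∀ k < N, f k ≠ f N) s = r) :
    P ({ω | X (N + 1) ω = X N ω + s} ∩ {ω | Q fun k ↦ X k ω}) =
      ENNReal.ofReal r * P {ω | Q fun k ↦ X k ω} := by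
  set extend : (Fin (N + 1) → ℤ) → ℕ → ℤ :=
    fun g k ↦ g (Fin.ofNat (N + 1) k) with hextend
  set H : Set (Fin (N + 1) → ℤ) := {g | Q (extend g)} with hH
  set E : (Fin (N + 1) → ℤ) → Set Ω := fun g ↦ {ω | ∀ k ≤ N, X k ω = extend g k} with hE
  have hEmeas : ∀ g, MeasurableSet (E g) := fun g ↦
    hX.measurableSet_history N (fun f ↦ ∀ k ≤ N, f k = extend g k)
      fun f f' hff' hf k hk ↦ (hff' k hk).symm.trans (hf k hk)
  have hstep : MeasurableSet {ω | X (N + 1) ω = X N ω + s} :=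
    measurableSet_eq_fun (hX.meas _) ((hX.meas _).add_const s)
  have hdisj : Pairwise (Function.onFun Disjoint E) := by
    intro g g' hgg'
    refine Set.disjoint_left.2 fun ω hω hω' ↦ hgg' (funext fun i ↦ ?_)
    have h1 := (hω i (by omega)).symm.trans (hω' i (by omega))
    simpa [hextend] using h1
  have hunion : {ω | Q fun k ↦ X k ω} = ⋃ g ∈ H, E g := by
    ext ω
    simp only [Set.mem_iUnion, Set.mem_ofPred_eq, exists_prop]
    constructor
    · intro hω
      have key : ∀ k ≤ N, X k ω = extend (fun i ↦ X i ω) k := by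
        intro k hk
        simp only [hextend]
        rw [Fin.val_ofNat, Nat.mod_eq_of_lt (by omega)]
      exact ⟨fun i ↦ X i ω, hQ _ _ key hω, key⟩
    · rintro ⟨g, hg, hω⟩
      exact hQ _ _ (fun k hk ↦ (hω k hk).symm) hg
  rw [hunion, Set.inter_iUnion₂,
    measure_biUnion (Set.to_countable H)
      (fun g _ g' _ hgg' ↦ (hdisj hgg').mono Set.inter_subset_right Set.inter_subset_right)
      (fun g _ ↦ hstep.inter (hEmeas g)),
    measure_biUnion (Set.to_countable H) (fun g _ g' _ hgg' ↦ hdisj hgg')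
      (fun g _ ↦ hEmeas g), ← ENNReal.tsum_mul_left]
  refine tsum_congr fun g ↦ ?_
  rw [← hr _ g.2, ← hX.step N (extend g) s]
  congr 1
  ext ω
  refine and_congr_left fun hω ↦ ?_
  rw [Set.mem_ofPred_eq, Set.mem_ofPred_eq, hω N le_rfl]

/-- The excited random walk is almost surely a nearest-neighbor path. -/
theorem IsERW1.ae_nearest_neighbor (hX : IsERW1 p P X) :
    ∀ᵐ ω ∂P, ∀ m, X (m + 1) ω = X m ω + 1 ∨ X (m + 1) ω = X m ω - 1 := by
  have h0 : ∀ᵐ ω ∂P, ∀ (m : ℕ) (s : ℤ), s ≠ 1 → s ≠ -1 → X (m + 1) ω ≠ X m ω + s := by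
    rw [ae_all_iff]
    intro m
    rw [ae_all_iff]
    intro s
    by_cases h1 : s = 1
    · simp [h1]
    by_cases h2 : s = -1
    · simp [h2]
    have := hX.measure_step_inter m (fun _ ↦ True) (fun _ _ _ _ ↦ trivial) s 0
      (fun f _ ↦ by rw [erw1StepProb, if_neg h1, if_neg h2])
    simp only [Set.ofPred_true, Set.inter_univ, ENNReal.ofReal_zero, zero_mul] at this
    rw [ae_iff]
    simpa [h1, h2] using this
  filter_upwards [h0] with ω hω m
  by_contra! hcon
  refine hω m (X (m + 1) ω - X m ω) ?_ ?_ (by ring)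
  · intro h; exact hcon.1 (by linarith)
  · intro h; exact hcon.2 (by linarith)

/-- The paths that follow `h` up to time `n`, then stay in `[1, x]` strictly before time `N`,
and are at `z` at time `N`. -/
def ConfinedPath (h : ℕ → ℤ) (n : ℕ) (x : ℤ) (N : ℕ) (z : ℤ) (f : ℕ → ℤ) : Prop :=
  (∀ k ≤ n, f k = h k) ∧ (∀ j, n < j → j < N → f j ∈ Finset.Icc 1 x) ∧ f N = z

theorem ConfinedPath.congr {h : ℕ → ℤ} {n : ℕ} {x : ℤ} {N : ℕ} {z : ℤ} (hN : n < N)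
    (f g : ℕ → ℤ) (hfg : ∀ k ≤ N, f k = g k) (hf : ConfinedPath h n x N z f) :
    ConfinedPath h n x N z g := by
  refine ⟨fun k hk ↦ ?_, fun j hj hjN ↦ ?_, ?_⟩
  · rw [← hfg k (by omega), hf.1 k hk]
  · rw [← hfg j hjN.le]
    exact hf.2.1 j hj hjN
  · rw [← hfg N le_rfl, hf.2.2]

/-- Inside the visited region the walk steps like a simple random walk. -/
theorem IsERW1.measureReal_confinedPath_succ (hX : IsERW1 p P X) {h : ℕ → ℤ} {n : ℕ} {x : ℤ}
    (hvisited : ∀ z ∈ Finset.Icc 1 x, ∃ k ≤ n, h k = z) {N : ℕ} (hN : n < N) (z : ℤ) :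
    P.real {ω | ConfinedPath h n x (N + 1) z fun k ↦ X k ω} =
      ∑ y ∈ Finset.Icc 1 x, erw1StepProb p False (z - y) *
        P.real {ω | ConfinedPath h n x N y fun k ↦ X k ω} := by
  have := hX.isProb
  have hunion : {ω | ConfinedPath h n x (N + 1) z fun k ↦ X k ω} =
      ⋃ y ∈ Finset.Icc 1 x, ({ω | X (N + 1) ω = X N ω + (z - y)} ∩
        {ω | ConfinedPath h n x N y fun k ↦ X k ω}) := by
    ext ω
    simp only [Set.mem_iUnion, Set.mem_inter_iff, Set.mem_ofPred_eq, exists_prop]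
    constructor
    · rintro ⟨h1, h2, h3⟩
      refine ⟨X N ω, h2 N hN (by omega), ?_, h1, fun j hj hjN ↦ h2 j hj (by omega), rfl⟩
      change X (N + 1) ω = z at h3
      rw [h3]
      ring
    · rintro ⟨y, hy, h0, h1, h2, h3⟩
      have h3' : X N ω = y := h3
      refine ⟨h1, fun j hj hjN ↦ ?_, ?_⟩
      · rcases Nat.lt_succ_iff_lt_or_eq.1 hjN with hlt | rfl
        · exact h2 j hj hlt
        · change X j ω ∈ Finset.Icc 1 x
          rwa [h3']
      · change X (N + 1) ω = z
        rw [h0, h3']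
        ring
  rw [hunion, measureReal_biUnion_finset]
  · refine Finset.sum_congr rfl fun y hy ↦ ?_
    have hq : 0 ≤ erw1StepProb p False (z - y) := by
      simp only [erw1StepProb, if_false]
      split_ifs <;> norm_num
    rw [measureReal_def, hX.measure_step_inter N _ (ConfinedPath.congr hN) (z - y)
      (erw1StepProb p False (z - y)), ENNReal.toReal_mul, ENNReal.toReal_ofReal hq,
      measureReal_def]
    intro f hf
    obtain ⟨k, hk, hky⟩ := hvisited y hy
    have : (∀ k < N, f k ≠ f N) = False := by
      refine eq_false fun hall ↦ hall k (by omega) ?_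
      rw [hf.1 k hk, hky, hf.2.2]
    rw [this]
  · intro y _ y' _ hyy'
    refine Set.disjoint_left.2 fun ω hω hω' ↦ hyy' ?_
    exact hω.2.2.2.symm.trans hω'.2.2.2
  · intro y _
    exact (measurableSet_eq_fun (hX.meas _) ((hX.meas _).add_const _)).inter
      (hX.measurableSet_history N _ (ConfinedPath.congr hN))

/-- A nearest-neighbor path following `h` reaches `x + 1` before `0` iff it leaves `[1, x]`
through `x + 1`. -/
theorem exists_confinedPath_iff {h : ℕ → ℤ} {n : ℕ} {x : ℤ} (hx : 0 < x) (hhn : h n = x)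
    {f : ℕ → ℤ} (hf : ∀ m, f (m + 1) = f m + 1 ∨ f (m + 1) = f m - 1) :
    (∃ k, ConfinedPath h n x (n + 1 + k) (x + 1) f) ↔
      (∃ m, n < m ∧ f m = x + 1 ∧ ∀ j, n < j → j < m → f j ≠ 0) ∧ ∀ k ≤ n, f k = h k := by
  constructor
  · rintro ⟨k, h1, h2, h3⟩
    refine ⟨⟨n + 1 + k, by omega, h3, fun j hj hjk ↦ ?_⟩, h1⟩
    have := Finset.mem_Icc.1 (h2 j hj hjk)
    omega
  · rintro ⟨⟨m, hm, hmx, hm0⟩, hA⟩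
    have hex : ∃ m, n < m ∧ f m = x + 1 := ⟨m, hm, hmx⟩
    obtain ⟨hl, hlx⟩ := Nat.find_spec hex
    have hlm : Nat.find hex ≤ m := Nat.find_min' hex ⟨hm, hmx⟩
    have hmin : ∀ j, n < j → j < Nat.find hex → f j ≠ x + 1 := fun j hj hjl hjx ↦
      Nat.find_min hex hjl ⟨hj, hjx⟩
    have hstay : ∀ i, n + i < Nat.find hex → 1 ≤ f (n + i) ∧ f (n + i) ≤ x := by
      intro i
      induction i with
      | zero =>
        intro _
        rw [add_zero, hA n le_rfl, hhn]
        omega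
      | succ i ih =>
        intro hi
        have h1 := ih (by omega)
        have h2 := hmin (n + (i + 1)) (by omega) hi
        have h3 := hm0 (n + (i + 1)) (by omega) (by omega)
        have h4 := hf (n + i)
        rw [← add_assoc] at h2 h3 ⊢
        omega
    refine ⟨Nat.find hex - (n + 1), hA, fun j hj hjl ↦ ?_, ?_⟩
    · have := hstay (j - n) (by omega)
      rw [Nat.add_sub_cancel' hj.le] at this
      exact Finset.mem_Icc.2 this
    · rw [Nat.add_sub_cancel' (by omega)]
      exact hlx

end Walk

/-- **Escape step for excited random walk on `ℤ`.**
Suppose that by time `n` the excited random walk (parameter `1/2 < p < 1`) has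
followed a history `h` so that it is at `x > 0` for the first time and every vertex
strictly between `0` and `x` has already been visited.  Then the conditional
probability that the walk reaches `x + 1` before reaching `0` equals
`p + (1-p)(1 - 2/(x+1)) = 1 - 2(1-p)/(x+1)`. -/
theorem excited_random_walk_Z_escape_step (p : ℝ) (hp : 1 / 2 < p) (hp1 : p < 1)
    {Ω : Type*} [MeasurableSpace Ω] (P : Measure Ω)
    (X : ℕ → Ω → ℤ) (hX : IsERW1 p P X)
    (n : ℕ) (h : ℕ → ℤ) (x : ℤ) (hx : 0 < x)
    (hh0 : h 0 = 0)
    (hsteps : ∀ k < n, h (k + 1) - h k = 1 ∨ h (k + 1) - h k = -1)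
    (hhn : h n = x)
    (hfirst : ∀ k < n, h k ≠ x)
    (hvisited : ∀ z : ℤ, 0 < z → z < x → ∃ k ≤ n, h k = z) :
    P ({ω | ∃ m, n < m ∧ X m ω = x + 1 ∧ ∀ j, n < j → j < m → X j ω ≠ 0} ∩
        {ω | ∀ k ≤ n, X k ω = h k}) =
      ENNReal.ofReal (1 - 2 * (1 - p) / ((x : ℝ) + 1)) *
        P {ω | ∀ k ≤ n, X k ω = h k} := by
  have := hX.isProb
  have hxR : (0 : ℝ) < x := by exact_mod_cast hx
  have hvis : ∀ z ∈ Finset.Icc 1 x, ∃ k ≤ n, h k = z := by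
    intro z hz
    rw [Finset.mem_Icc] at hz
    rcases hz.2.lt_or_eq with hlt | rfl
    · exact hvisited z (by omega) hlt
    · exact ⟨n, le_rfl, hhn⟩
  set c : ℕ → ℤ → ℝ := fun k z ↦
    P.real {ω | ConfinedPath h n x (n + 1 + k) z fun k ↦ X k ω} with hc
  have hc0 : ∀ z, c 0 z =
      erw1StepProb p True (z - x) * P.real {ω | ∀ k ≤ n, X k ω = h k} := by
    intro z
    have hset : {ω | ConfinedPath h n x (n + 1 + 0) z fun k ↦ X k ω} =
        {ω | X (n + 1) ω = h n + (z - x)} ∩ {ω | ∀ k ≤ n, X k ω = h k} := by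
      ext ω
      constructor
      · rintro ⟨h1, -, h3⟩
        refine ⟨?_, h1⟩
        change X (n + 1) ω = z at h3
        rw [Set.mem_ofPred_eq, h3, hhn]
        ring
      · rintro ⟨h0, h1⟩
        refine ⟨h1, fun j hj hj' ↦ by omega, ?_⟩
        rw [Set.mem_ofPred_eq, hhn] at h0
        change X (n + 1) ω = z
        rw [h0]
        ring
    have hfst : (∀ k < n, h k ≠ h n) = True := eq_true (by rwa [hhn])
    have hq : 0 ≤ erw1StepProb p True (z - x) := by
      simp only [erw1StepProb, if_true]
      split_ifs <;> linarith
    simp only [hc]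
    rw [hset, measureReal_def, hX.step, hfst, ENNReal.toReal_mul, ENNReal.toReal_ofReal hq,
      measureReal_def]
  have hsum := hasSum_killed_exit_right p hx c (fun _ _ ↦ measureReal_nonneg)
    (fun k z ↦ hX.measureReal_confinedPath_succ (N := n + 1 + k) hvis (by omega) z)
  have hmean : (∑ z ∈ Finset.Icc 0 (x + 1), (z : ℝ) * c 0 z) / ((x : ℝ) + 1) =
      (1 - 2 * (1 - p) / ((x : ℝ) + 1)) * P.real {ω | ∀ k ≤ n, X k ω = h k} := by
    simp_rw [hc0, ← mul_assoc]
    rw [← Finset.sum_mul, sum_mul_erw1StepProb p True (Finset.mem_Icc.2 ⟨hx, le_rfl⟩)]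
    norm_num [erw1StepProb]
    field_simp
    ring
  rw [hmean] at hsum
  have hae : ({ω | ∃ m, n < m ∧ X m ω = x + 1 ∧ ∀ j, n < j → j < m → X j ω ≠ 0} ∩
        {ω | ∀ k ≤ n, X k ω = h k} : Set Ω) =ᵐ[P]
      ⋃ k, {ω | ConfinedPath h n x (n + 1 + k) (x + 1) fun k ↦ X k ω} := by
    filter_upwards [hX.ae_nearest_neighbor] with ω hω
    have := exists_confinedPath_iff hx hhn (f := fun k ↦ X k ω) hω
    exact propext (this.symm.trans
      (Set.mem_iUnion (s := fun k ↦
        {ω | ConfinedPath h n x (n + 1 + k) (x + 1) fun k ↦ X k ω})).symm)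
  have hdisj : Pairwise (Function.onFun Disjoint fun k ↦
      {ω | ConfinedPath h n x (n + 1 + k) (x + 1) fun k ↦ X k ω}) := by
    refine (pairwise_disjoint_on _).2 fun k l hkl ↦ ?_
    refine Set.disjoint_left.2 fun ω hk hl ↦ ?_
    have h1 := Finset.mem_Icc.1 (hl.2.1 (n + 1 + k) (by omega) (by omega))
    have h2 := hk.2.2
    omega
  rw [measure_congr hae, measure_iUnion hdisj
    fun k ↦ hX.measurableSet_history (n + 1 + k) _ (ConfinedPath.congr (by omega))]
  have hterm : ∀ k, P {ω | ConfinedPath h n x (n + 1 + k) (x + 1) fun k ↦ X k ω} =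
      ENNReal.ofReal (c k (x + 1)) := fun k ↦ (ofReal_measureReal).symm
  have hcoef : 0 ≤ 1 - 2 * (1 - p) / ((x : ℝ) + 1) := by
    rw [sub_nonneg, div_le_one (by linarith)]
    linarith
  simp_rw [hterm]
  rw [← ENNReal.ofReal_tsum_of_nonneg (fun k ↦ measureReal_nonneg) hsum.summable, hsum.tsum_eq,
    ENNReal.ofReal_mul hcoef, ofReal_measureReal]
end
end

section
/- There are positive constants c, C and r_0 such that for every (x,y) ∈ Z^2 with polar radius r = sqrt(x²+y²) ≥ r_0, the probability q(x,y) that (x,y) is a tan point for simple random walk on Z^2 started at the origin satisfies: if x ≥ 0 then c·r^{−1/2} ≤ q(x,y) ≤ C·r^{−1/2}, and if x ≤ 0 then c·|y|·r^{−3/2} ≤ q(x,y) ≤ C·|y|·r^{−3/2}. -/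
open MeasureTheory
open scoped Classical

noncomputable section

/-- Step distribution of the excited random walk on `ℤ²` with bias `ε/2`:
on a first visit to a vertex (`first` holds) the walker steps right with
probability `(1+ε)/4`, left with probability `(1-ε)/4`, and up or down with
probability `1/4` each; on subsequent visits all four neighbors have
probability `1/4`.  For `ε = 0` this is the step distribution of simple
random walk. -/
def erw2StepProb (ε : ℝ) (first : Prop) (s : ℤ × ℤ) : ℝ :=
  if s = (1, 0) then (1 + if first then ε else 0) / 4
  else if s = (-1, 0) then (1 - if first then ε else 0) / 4
  else if s = (0, 1) ∨ s = (0, -1) then 1 / 4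
  else 0

/-- `X` is an excited random walk on `ℤ²` with bias `ε/2`, started at `v`, under
the probability measure `P`: conditionally on any initial history, the next step
has the distribution `erw2StepProb`, where "first visit" means that the current
position was not visited at any earlier time. -/
structure IsERW2 (ε : ℝ) (v : ℤ × ℤ) {Ω : Type*} [MeasurableSpace Ω]
    (P : Measure Ω) (X : ℕ → Ω → ℤ × ℤ) : Prop where
  isProb : IsProbabilityMeasure P
  meas : ∀ n, Measurable (X n)
  start : ∀ᵐ ω ∂P, X 0 ω = v
  step : ∀ (n : ℕ) (h : ℕ → ℤ × ℤ) (s : ℤ × ℤ),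
    P ({ω | X (n + 1) ω = h n + s} ∩ {ω | ∀ k ≤ n, X k ω = h k}) =
      ENNReal.ofReal (erw2StepProb ε (∀ k < n, h k ≠ h n) s) *
        P {ω | ∀ k ≤ n, X k ω = h k}

/-- Simple random walk on `ℤ²` started at `v` (excited random walk with bias `0`). -/
abbrev IsSRW2 (v : ℤ × ℤ) {Ω : Type*} [MeasurableSpace Ω]
    (P : Measure Ω) (X : ℕ → Ω → ℤ × ℤ) : Prop := IsERW2 0 v P X

/-- `v` is a tan point for the walk `X` in outcome `ω`: `v` is visited before any
point of the form `(x', v.2)` with `x' > v.1`. -/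
def IsTanPoint {Ω : Type*} (X : ℕ → Ω → ℤ × ℤ) (ω : Ω) (v : ℤ × ℤ) : Prop :=
  ∃ n, X n ω = v ∧ ∀ m < n, ¬((X m ω).2 = v.2 ∧ v.1 < (X m ω).1)

/-- `v` is a tan point for the walk `X` in outcome `ω`, witnessed strictly before
time `N`: `v` is visited at some time `n < N`, before any point `(x', v.2)` with
`x' > v.1`. -/
def TanPointBy {Ω : Type*} (X : ℕ → Ω → ℤ × ℤ) (ω : Ω) (v : ℤ × ℤ) (N : ℕ) : Prop :=
  ∃ n < N, X n ω = v ∧ ∀ m < n, ¬((X m ω).2 = v.2 ∧ v.1 < (X m ω).1)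

/-- The polar radius `r = sqrt (x² + y²)` of a lattice point. -/
def polarR (v : ℤ × ℤ) : ℝ := Real.sqrt ((v.1 : ℝ) ^ 2 + (v.2 : ℝ) ^ 2)

/-- The polar angle `θ ∈ [0, 2π)` of a lattice point, so that
`x = r cos θ` and `y = r sin θ`. -/
def polarTheta (v : ℤ × ℤ) : ℝ :=
  if 0 ≤ Complex.arg ⟨(v.1 : ℝ), (v.2 : ℝ)⟩ then Complex.arg ⟨(v.1 : ℝ), (v.2 : ℝ)⟩
  else Complex.arg ⟨(v.1 : ℝ), (v.2 : ℝ)⟩ + 2 * Real.pi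

/-- The average of `u` over the four lattice neighbors of `p`. -/
def latticeMean (u : ℤ × ℤ → ℝ) (p : ℤ × ℤ) : ℝ :=
  (u (p.1 + 1, p.2) + u (p.1 - 1, p.2) + u (p.1, p.2 + 1) + u (p.1, p.2 - 1)) / 4

/-- The closed half-line `{(x, 0) : x ≤ 0}`. -/
def OnSlit (p : ℤ × ℤ) : Prop := p.2 = 0 ∧ p.1 ≤ 0

/-- The function `r^{-1/2} cos (θ/2)`, the real part of the principal branch of `z ^ (-1/2)`. -/
def slitFun (p : ℤ × ℤ) : ℝ := Real.sqrt ((polarR p + p.1) / 2) / polarR p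

/-- A lattice point as a complex number. -/
def latticeToComplex (p : ℤ × ℤ) : ℂ := ⟨p.1, p.2⟩

lemma polarR_nonneg (p : ℤ × ℤ) : 0 ≤ polarR p := Real.sqrt_nonneg _

lemma polarR_sq (p : ℤ × ℤ) : polarR p ^ 2 = (p.1 : ℝ) ^ 2 + (p.2 : ℝ) ^ 2 :=
  Real.sq_sqrt (by positivity)

lemma norm_latticeToComplex (p : ℤ × ℤ) : ‖latticeToComplex p‖ = polarR p := by
  rw [polarR, Complex.norm_eq_sqrt_sq_add_sq]
  rfl

lemma abs_fst_le_polarR (p : ℤ × ℤ) : |(p.1 : ℝ)| ≤ polarR p :=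
  Real.abs_le_sqrt (by nlinarith [sq_nonneg (p.2 : ℝ)])

lemma abs_snd_le_polarR (p : ℤ × ℤ) : |(p.2 : ℝ)| ≤ polarR p :=
  Real.abs_le_sqrt (by nlinarith [sq_nonneg (p.1 : ℝ)])

lemma polarR_add_fst_nonneg (p : ℤ × ℤ) : 0 ≤ polarR p + p.1 := by
  have := abs_le.1 (abs_fst_le_polarR p)
  linarith

lemma slitFun_nonneg (p : ℤ × ℤ) : 0 ≤ slitFun p :=
  div_nonneg (Real.sqrt_nonneg _) (polarR_nonneg p)

lemma slitFun_sq (p : ℤ × ℤ) : slitFun p ^ 2 = (polarR p + p.1) / 2 / polarR p ^ 2 := by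
  rw [slitFun, div_pow, Real.sq_sqrt (by linarith [polarR_add_fst_nonneg p])]

lemma slitFun_eq_zero_of_onSlit {p : ℤ × ℤ} (hp : OnSlit p) : slitFun p = 0 := by
  have h : polarR p = -(p.1 : ℝ) := by
    have h1 : (p.1 : ℝ) ≤ 0 := by exact_mod_cast hp.2
    rw [polarR, hp.1, ← Real.sqrt_sq (neg_nonneg.2 h1)]
    simp
  simp [slitFun, h]

lemma polarR_pos_of_not_onSlit {p : ℤ × ℤ} (hp : ¬ OnSlit p) : 0 < polarR p := by
  refine (polarR_nonneg p).lt_of_ne fun h => hp ?_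
  have h2 := polarR_sq p
  rw [← h] at h2
  have hx : (p.1 : ℝ) = 0 := by nlinarith [sq_nonneg (p.1 : ℝ), sq_nonneg (p.2 : ℝ)]
  have hy : (p.2 : ℝ) = 0 := by nlinarith [sq_nonneg (p.1 : ℝ), sq_nonneg (p.2 : ℝ)]
  exact ⟨by exact_mod_cast hy, by exact_mod_cast hx.le⟩

lemma slitFun_pos_of_not_onSlit {p : ℤ × ℤ} (hp : ¬ OnSlit p) : 0 < slitFun p := by
  have hr := polarR_pos_of_not_onSlit hp
  have h2 := polarR_sq p
  refine div_pos (Real.sqrt_pos.2 ?_) hr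
  by_cases hy : p.2 = 0
  · have hx : (0 : ℝ) < p.1 := by
      have : ¬ p.1 ≤ 0 := fun h => hp ⟨hy, h⟩
      exact_mod_cast not_le.1 this
    linarith
  · have hy' : (0 : ℝ) < (p.2 : ℝ) ^ 2 := by positivity
    nlinarith [polarR_add_fst_nonneg p]

lemma slitFun_le_inv_sqrt (p : ℤ × ℤ) : slitFun p ≤ (Real.sqrt (polarR p))⁻¹ := by
  refine (sq_le_sq₀ (slitFun_nonneg p) (by positivity)).1 ?_
  rw [slitFun_sq, inv_pow, Real.sq_sqrt (polarR_nonneg p)]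
  rcases (polarR_nonneg p).eq_or_lt with h | h
  · simp [← h]
  · have := abs_le.1 (abs_fst_le_polarR p)
    rw [div_le_iff₀ (by positivity), sq, inv_mul_cancel_left₀ h.ne']
    linarith

/-- A square root of `1 / (1 + x)` near `1`, together with its second order expansion. -/
lemma exists_inv_sqrt_one_add (x : ℂ) (hx : ‖x‖ ≤ 1 / 2) :
    ∃ g : ℂ, g ^ 2 * (1 + x) = 1 ∧ 0 < g.re ∧
      ‖g - (1 - x / 2 + 3 * x ^ 2 / 8)‖ ≤ 4 * ‖x‖ ^ 3 := by
  have hn0 := norm_nonneg x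
  have h1x : 1 / 2 ≤ ‖1 + x‖ := by
    have := norm_sub_le (1 + x) x
    simp only [add_sub_cancel_right, norm_one] at this
    linarith
  have h1x0 : 1 + x ≠ 0 := by
    intro h
    rw [h, norm_zero] at h1x
    norm_num at h1x
  have hre : |x.re| ≤ 1 / 2 := (Complex.abs_re_le_norm x).trans hx
  have hre0 : 0 < (1 + x).re := by
    have := (abs_le.1 hre).1
    simp
    linarith
  obtain ⟨g, hg, hg0⟩ : ∃ g : ℂ, g ^ 2 = (1 + x)⁻¹ ∧ 0 ≤ g.re := by
    obtain ⟨g, hg⟩ := IsAlgClosed.exists_pow_nat_eq (1 + x)⁻¹ (n := 2) (by norm_num)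
    rcases le_total 0 g.re with h | h
    · exact ⟨g, hg, h⟩
    · exact ⟨-g, by rw [neg_sq, hg], by simpa using h⟩
  have hg1 : g ^ 2 * (1 + x) = 1 := by rw [hg, inv_mul_cancel₀ h1x0]
  have hgpos : 0 < g.re := by
    refine hg0.lt_of_ne fun h => ?_
    have h2 : (g ^ 2).re = -(g.im ^ 2) := by
      rw [sq, Complex.mul_re, ← h]
      ring
    have h3 : 0 < ((1 + x)⁻¹).re := by
      rw [Complex.inv_re]
      exact div_pos hre0 (Complex.normSq_pos.2 h1x0)
    rw [← hg, h2] at h3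
    nlinarith [sq_nonneg g.im]
  refine ⟨g, hg1, hgpos, ?_⟩
  set q : ℂ := 1 - x / 2 + 3 * x ^ 2 / 8 with hq
  have hq1 : ‖q - 1‖ ≤ 3 / 8 := by
    have : q - 1 = -(x / 2) + 3 * x ^ 2 / 8 := by rw [hq]; ring
    rw [this]
    refine (norm_add_le _ _).trans ?_
    simp only [norm_neg, norm_div, norm_mul, norm_pow, Complex.norm_ofNat]
    nlinarith
  have hqre : 5 / 8 ≤ q.re := by
    have := (abs_le.1 ((Complex.abs_re_le_norm (q - 1)).trans hq1)).1
    simp at this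
    linarith
  have hgq : 1 / 2 ≤ ‖g + q‖ := by
    have := Complex.re_le_norm (g + q)
    simp at this
    linarith
  have key : (g - q) * ((g + q) * (1 + x)) =
      -(x ^ 3 * (5 / 8 - 15 / 64 * x + 9 / 64 * x ^ 2)) := by
    have : (g - q) * ((g + q) * (1 + x)) = 1 - q ^ 2 * (1 + x) := by
      linear_combination hg1
    rw [this, hq]
    ring
  have hkey := congrArg norm key
  rw [norm_mul, norm_mul, norm_neg, norm_mul, norm_pow] at hkey
  have hc : ‖(5 / 8 - 15 / 64 * x + 9 / 64 * x ^ 2 : ℂ)‖ ≤ 1 := by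
    refine (norm_add_le _ _).trans ?_
    have := norm_sub_le (5 / 8 : ℂ) (15 / 64 * x)
    simp only [norm_div, norm_mul, norm_pow, Complex.norm_ofNat] at this ⊢
    nlinarith
  have h4 : 1 / 4 ≤ ‖g + q‖ * ‖1 + x‖ := by nlinarith
  have h5 : ‖x‖ ^ 3 * ‖(5 / 8 - 15 / 64 * x + 9 / 64 * x ^ 2 : ℂ)‖ ≤ ‖x‖ ^ 3 :=
    mul_le_of_le_one_right (by positivity) hc
  nlinarith [norm_nonneg (g - q)]

lemma slitFun_eq_abs_re {p : ℤ × ℤ} {F : ℂ} (hF : F ^ 2 * latticeToComplex p = 1) :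
    slitFun p = |F.re| := by
  have hz : latticeToComplex p ≠ 0 := by
    rintro h
    simp [h] at hF
  have hr : 0 < polarR p := by rw [← norm_latticeToComplex]; exact norm_pos_iff.2 hz
  have hF2 : F ^ 2 = (latticeToComplex p)⁻¹ := eq_inv_of_mul_eq_one_left hF
  have hre : F.re ^ 2 - F.im ^ 2 = p.1 / polarR p ^ 2 := by
    have := congrArg Complex.re hF2
    rw [Complex.inv_re, Complex.normSq_eq_norm_sq, norm_latticeToComplex, sq,
      Complex.mul_re] at this
    rw [sq, sq, this]
    rfl
  have hn : F.re ^ 2 + F.im ^ 2 = 1 / polarR p := by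
    have := congrArg norm hF2
    rw [norm_pow, norm_inv, norm_latticeToComplex, ← Complex.normSq_eq_norm_sq,
      Complex.normSq_apply] at this
    rw [one_div, ← this]
    ring
  rw [← abs_of_nonneg (slitFun_nonneg p), ← sq_eq_sq_iff_abs_eq_abs, slitFun_sq]
  have : F.re ^ 2 = (1 / polarR p + p.1 / polarR p ^ 2) / 2 := by linarith
  rw [this]
  field_simp

/-- Along a lattice step that does not cross the slit, `slitFun` follows the branch of
the inverse square root. -/
lemma slitFun_neighbor_eq_re {p q : ℤ × ℤ} (hp : ¬ OnSlit p) {F g s : ℂ}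
    (hF : F ^ 2 * latticeToComplex p = 1) (hF0 : 0 ≤ F.re)
    (hg : g ^ 2 * (1 + s * (latticeToComplex p)⁻¹) = 1) (hg0 : 0 < g.re)
    (hq : latticeToComplex q = latticeToComplex p + s)
    (hpos : 0 < p.2 → 0 ≤ q.2) (hneg : p.2 < 0 → q.2 ≤ 0) :
    slitFun q = (F * g).re := by
  have hz : latticeToComplex p ≠ 0 := by
    rintro h
    simp [h] at hF
  have hFq : (F * g) ^ 2 * latticeToComplex q = 1 := by
    have : latticeToComplex q = latticeToComplex p * (1 + s * (latticeToComplex p)⁻¹) := by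
      rw [hq]; field_simp
    rw [this]
    linear_combination (g ^ 2 * (1 + s * (latticeToComplex p)⁻¹)) * hF + hg
  rw [slitFun_eq_abs_re hFq, abs_of_nonneg]
  have hFre : 0 < F.re := by
    have := slitFun_pos_of_not_onSlit hp
    rwa [slitFun_eq_abs_re hF, abs_of_nonneg hF0] at this
  have him : ∀ (G : ℂ) (a : ℤ × ℤ), G ^ 2 * latticeToComplex a = 1 →
      ∃ c : ℝ, 0 < c ∧ 2 * (G.re * G.im) = -(a.2 * c) := by
    intro G a hG
    have ha : latticeToComplex a ≠ 0 := by
      rintro h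
      simp [h] at hG
    have := congrArg Complex.im (eq_inv_of_mul_eq_one_left hG)
    rw [Complex.inv_im, sq, Complex.mul_im] at this
    refine ⟨(Complex.normSq (latticeToComplex a))⁻¹, inv_pos.2 (Complex.normSq_pos.2 ha), ?_⟩
    have h2 : (latticeToComplex a).im = a.2 := rfl
    rw [h2, neg_div, div_eq_mul_inv] at this
    linarith
  obtain ⟨c, hc, h1⟩ := him F p hF
  obtain ⟨d, hd, h2⟩ := him (F * g) q hFq
  by_contra! hlt
  have hin : 0 < F.re * (F * g).re + F.im * (F * g).im := by
    have : F.re * (F * g).re + F.im * (F * g).im = (F.re ^ 2 + F.im ^ 2) * g.re := by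
      simp only [Complex.mul_re, Complex.mul_im]
      ring
    rw [this]
    positivity
  rcases lt_trichotomy p.2 0 with h | h | h
  · have hq2 : (q.2 : ℝ) ≤ 0 := by exact_mod_cast hneg h
    have hp2 : (p.2 : ℝ) < 0 := by exact_mod_cast h
    have h3 : 0 < F.im := by nlinarith
    have h4 : (F * g).im ≤ 0 := by nlinarith
    nlinarith
  · have h3 : F.im = 0 := by
      rw [h] at h1
      have : F.re * F.im = 0 := by push_cast at h1; linarith
      exact (mul_eq_zero.1 this).resolve_left hFre.ne'
    rw [h3] at hin
    nlinarith
  · have hq2 : (0 : ℝ) ≤ q.2 := by exact_mod_cast hpos h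
    have hp2 : (0 : ℝ) < p.2 := by exact_mod_cast h
    have h3 : F.im < 0 := by nlinarith
    have h4 : 0 ≤ (F * g).im := by nlinarith
    nlinarith

/-- Away from the tip, `slitFun - slitFun ^ 2` is strictly superharmonic and
`slitFun + slitFun ^ 2` is strictly subharmonic off the slit. -/
lemma latticeMean_slitFun {p : ℤ × ℤ} (hp : ¬ OnSlit p) (hr : 160000 ≤ polarR p) :
    latticeMean (fun q => slitFun q - slitFun q ^ 2) p < slitFun p - slitFun p ^ 2 ∧
      slitFun p + slitFun p ^ 2 < latticeMean (fun q => slitFun q + slitFun q ^ 2) p := by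
  set z := latticeToComplex p with hz
  set w := z⁻¹ with hw
  have hnz : ‖z‖ = polarR p := norm_latticeToComplex p
  have hz0 : z ≠ 0 := norm_pos_iff.1 (by linarith)
  obtain ⟨F, hF, hF0⟩ : ∃ F : ℂ, F ^ 2 * z = 1 ∧ 0 ≤ F.re := by
    obtain ⟨F, hF⟩ := IsAlgClosed.exists_pow_nat_eq w (n := 2) (by norm_num)
    rcases le_total 0 F.re with h | h
    · exact ⟨F, by rw [hF, inv_mul_cancel₀ hz0], h⟩
    · exact ⟨-F, by rw [neg_sq, hF, inv_mul_cancel₀ hz0], by simpa using h⟩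
  set ρ := ‖F‖ with hρ
  have hρ0 : 0 ≤ ρ := norm_nonneg F
  have hFw : F ^ 2 = w := eq_inv_of_mul_eq_one_left hF
  have hwρ : ‖w‖ = ρ ^ 2 := by rw [← hFw, norm_pow]
  have hρr : ρ ^ 2 * polarR p = 1 := by
    rw [← hwρ, ← hnz, hw, norm_inv, inv_mul_cancel₀ (norm_ne_zero_iff.2 hz0)]
  have hρpos : 0 < ρ := by
    refine hρ0.lt_of_ne fun h => ?_
    rw [← h] at hρr
    simp at hρr
  have hρ1 : ρ ≤ 1 / 400 := by nlinarith
  have hfp : slitFun p = F.re := by rw [slitFun_eq_abs_re hF, abs_of_nonneg hF0]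
  have hfρ : slitFun p ≤ ρ := by rw [hfp]; exact Complex.re_le_norm F
  set Z := F * w / 2 with hZ
  have hZn : Z.re ^ 2 + Z.im ^ 2 = ρ ^ 6 / 4 := by
    have h1 : ‖Z‖ = ρ ^ 3 / 2 := by
      rw [hZ, norm_div, norm_mul, hwρ, Complex.norm_ofNat]
      ring
    have h2 : Z.re ^ 2 + Z.im ^ 2 = ‖Z‖ ^ 2 := by
      rw [← Complex.normSq_eq_norm_sq, Complex.normSq_apply]
      ring
    rw [h2, h1]
    ring
  have step : ∀ (s : ℂ) (q : ℤ × ℤ), ‖s‖ = 1 → latticeToComplex q = z + s →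
      (0 < p.2 → 0 ≤ q.2) → (p.2 < 0 → q.2 ≤ 0) →
      ∃ e : ℝ, |e| ≤ 4 * ρ ^ 7 ∧
        slitFun q - slitFun p = -(s * Z).re + (3 / 8 * s ^ 2 * (F * w ^ 2)).re + e ∧
        |slitFun q - slitFun p + (s * Z).re| ≤ ρ ^ 5 := by
    intro s q hs hq h1 h2
    have hsw : ‖s * w‖ = ρ ^ 2 := by rw [norm_mul, hs, one_mul, hwρ]
    obtain ⟨g, hg, hg0, hge⟩ := exists_inv_sqrt_one_add (s * w) (by rw [hsw]; nlinarith)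
    have hfq : slitFun q = (F * g).re := slitFun_neighbor_eq_re hp hF hF0 hg hg0 hq h1 h2
    set η := g - (1 - s * w / 2 + 3 * (s * w) ^ 2 / 8) with hη
    have hηn : |(F * η).re| ≤ 4 * ρ ^ 7 := by
      refine (Complex.abs_re_le_norm _).trans ?_
      rw [norm_mul]
      rw [hsw] at hge
      calc ρ * ‖η‖ ≤ ρ * (4 * (ρ ^ 2) ^ 3) := by gcongr
        _ = 4 * ρ ^ 7 := by ring
    have hsum : slitFun q - slitFun p =
        -(s * Z).re + (3 / 8 * s ^ 2 * (F * w ^ 2)).re + (F * η).re := by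
      rw [hfq, hfp, ← Complex.neg_re, ← Complex.sub_re, ← Complex.add_re, ← Complex.add_re]
      congr 1
      rw [hη, hZ]
      ring
    refine ⟨_, hηn, hsum, ?_⟩
    have h3 : |(3 / 8 * s ^ 2 * (F * w ^ 2)).re| ≤ 3 / 8 * ρ ^ 5 := by
      refine (Complex.abs_re_le_norm _).trans (le_of_eq ?_)
      simp only [norm_mul, norm_pow, norm_div, Complex.norm_ofNat, hs, hwρ]
      ring
    have h4 : 4 * ρ ^ 7 ≤ 5 / 8 * ρ ^ 5 := by
      have : 4 * ρ ^ 2 ≤ 5 / 8 := by nlinarith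
      calc 4 * ρ ^ 7 = 4 * ρ ^ 2 * ρ ^ 5 := by ring
        _ ≤ _ := by gcongr
    rw [abs_le] at h3 hηn ⊢
    constructor <;> linarith
  obtain ⟨e₁, he₁, h₁, k₁⟩ := step 1 (p.1 + 1, p.2) (by simp)
    (by apply Complex.ext <;> simp [hz, latticeToComplex]) le_of_lt le_of_lt
  obtain ⟨e₂, he₂, h₂, k₂⟩ := step (-1) (p.1 - 1, p.2) (by simp)
    (by apply Complex.ext <;> simp [hz, latticeToComplex, sub_eq_add_neg]) le_of_lt le_of_lt
  obtain ⟨e₃, he₃, h₃, k₃⟩ := step Complex.I (p.1, p.2 + 1) (by simp)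
    (by apply Complex.ext <;> simp [hz, latticeToComplex]) (fun h => by simp; omega)
    (fun h => by simp; omega)
  obtain ⟨e₄, he₄, h₄, k₄⟩ := step (-Complex.I) (p.1, p.2 - 1) (by simp)
    (by apply Complex.ext <;> simp [hz, latticeToComplex, sub_eq_add_neg])
    (fun h => by simp; omega) (fun h => by simp; omega)
  simp only [latticeMean]
  set a := slitFun (p.1 + 1, p.2) - slitFun p with ha
  set b := slitFun (p.1 - 1, p.2) - slitFun p with hb
  set c := slitFun (p.1, p.2 + 1) - slitFun p with hc
  set d := slitFun (p.1, p.2 - 1) - slitFun p with hd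
  have ea : slitFun (p.1 + 1, p.2) = slitFun p + a := by rw [ha]; ring
  have eb : slitFun (p.1 - 1, p.2) = slitFun p + b := by rw [hb]; ring
  have ec : slitFun (p.1, p.2 + 1) = slitFun p + c := by rw [hc]; ring
  have ed : slitFun (p.1, p.2 - 1) = slitFun p + d := by rw [hd]; ring
  rw [ea, eb, ec, ed]
  have hE : |a + b + c + d| ≤ 16 * ρ ^ 7 := by
    have : a + b + c + d = e₁ + e₂ + e₃ + e₄ := by
      rw [h₁, h₂, h₃, h₄]
      simp
      ring
    rw [this]
    rw [abs_le] at *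
    constructor <;> linarith
  have hV : ρ ^ 6 / 4 - 4 * ρ ^ 10 ≤ a ^ 2 + b ^ 2 + c ^ 2 + d ^ 2 := by
    have key : ∀ u t : ℝ, |u + t| ≤ ρ ^ 5 → t ^ 2 / 2 - ρ ^ 10 ≤ u ^ 2 := by
      intro u t h
      have : (u + t) ^ 2 ≤ ρ ^ 10 := by
        calc (u + t) ^ 2 = |u + t| ^ 2 := (sq_abs _).symm
          _ ≤ (ρ ^ 5) ^ 2 := by gcongr
          _ = ρ ^ 10 := by ring
      nlinarith [sq_nonneg (2 * u + t)]
    have l₁ := key _ _ k₁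
    have l₂ := key _ _ k₂
    have l₃ := key _ _ k₃
    have l₄ := key _ _ k₄
    simp only [Complex.mul_re, Complex.neg_re, Complex.neg_im, Complex.one_re, Complex.one_im,
      Complex.I_re, Complex.I_im] at l₁ l₂ l₃ l₄
    linarith
  have hf0 := slitFun_nonneg p
  have hfE : |slitFun p * (a + b + c + d)| ≤ 16 * ρ ^ 7 := by
    rw [abs_mul, abs_of_nonneg hf0]
    calc slitFun p * |a + b + c + d| ≤ 1 * (16 * ρ ^ 7) := by gcongr; linarith
      _ = 16 * ρ ^ 7 := one_mul _
  have hfin : 48 * ρ ^ 7 < ρ ^ 6 / 4 - 4 * ρ ^ 10 := by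
    have h1 : 0 < ρ ^ 6 := by positivity
    have h2 : ρ ^ 4 ≤ 1 / 400 := by
      calc ρ ^ 4 ≤ ρ ^ 1 := pow_le_pow_of_le_one hρ0 (by linarith) (by norm_num)
        _ ≤ 1 / 400 := by simpa using hρ1
    have h3 : ρ ^ 6 * (48 * ρ + 4 * ρ ^ 4) < ρ ^ 6 * (1 / 4) := by
      gcongr
      linarith
    linarith
  rw [abs_le] at hE hfE
  constructor <;> linarith

/-- The probability that simple random walk from `p` visits the origin within `n` steps,
before any other point of the slit. -/
def slitHit : ℕ → ℤ × ℤ → ℝ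
  | 0, p => if p = 0 then 1 else 0
  | n + 1, p => if p = 0 then 1 else if OnSlit p then 0 else latticeMean (slitHit n) p

/-- The probability that simple random walk from `p` visits the origin before any other point
of the slit. -/
def slitHitLim (p : ℤ × ℤ) : ℝ := ⨆ n, slitHit n p

lemma abs_polarR_sub_le {p q : ℤ × ℤ} {s : ℂ} (hs : ‖s‖ = 1)
    (h : latticeToComplex q = latticeToComplex p + s) : |polarR q - polarR p| ≤ 1 := by
  rw [← norm_latticeToComplex, ← norm_latticeToComplex, h]
  refine (abs_norm_sub_norm_le _ _).trans ?_
  rw [add_sub_cancel_left, hs]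

lemma latticeMean_le_latticeMean {u w : ℤ × ℤ → ℝ} {p : ℤ × ℤ}
    (h : ∀ q, |polarR q - polarR p| ≤ 1 → u q ≤ w q) : latticeMean u p ≤ latticeMean w p := by
  have h₁ := h (p.1 + 1, p.2) (abs_polarR_sub_le (s := 1) (by simp)
    (by apply Complex.ext <;> simp [latticeToComplex]))
  have h₂ := h (p.1 - 1, p.2) (abs_polarR_sub_le (s := -1) (by simp)
    (by apply Complex.ext <;> simp [latticeToComplex, sub_eq_add_neg]))
  have h₃ := h (p.1, p.2 + 1) (abs_polarR_sub_le (s := Complex.I) (by simp)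
    (by apply Complex.ext <;> simp [latticeToComplex]))
  have h₄ := h (p.1, p.2 - 1) (abs_polarR_sub_le (s := -Complex.I) (by simp)
    (by apply Complex.ext <;> simp [latticeToComplex, sub_eq_add_neg]))
  simp only [latticeMean]
  linarith

lemma latticeMean_const_mul (a : ℝ) (u : ℤ × ℤ → ℝ) (p : ℤ × ℤ) :
    latticeMean (fun q => a * u q) p = a * latticeMean u p := by
  simp only [latticeMean]
  ring

lemma latticeMean_add_const (a : ℝ) (u : ℤ × ℤ → ℝ) (p : ℤ × ℤ) :
    latticeMean (fun q => u q + a) p = latticeMean u p + a := by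
  simp only [latticeMean]
  ring

lemma not_onSlit_ne_zero {p : ℤ × ℤ} (hp : ¬ OnSlit p) : p ≠ 0 := by
  rintro rfl
  exact hp ⟨rfl, le_rfl⟩

lemma slitHit_nonneg (n : ℕ) (p : ℤ × ℤ) : 0 ≤ slitHit n p := by
  induction n generalizing p with
  | zero => rw [slitHit]; split_ifs <;> norm_num
  | succ n ih =>
    rw [slitHit]
    split_ifs
    · exact zero_le_one
    · exact le_rfl
    · have := ih (p.1 + 1, p.2)
      have := ih (p.1 - 1, p.2)
      have := ih (p.1, p.2 + 1)
      have := ih (p.1, p.2 - 1)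
      simp only [latticeMean]
      positivity

lemma slitHit_le_one (n : ℕ) (p : ℤ × ℤ) : slitHit n p ≤ 1 := by
  induction n generalizing p with
  | zero => rw [slitHit]; split_ifs <;> norm_num
  | succ n ih =>
    rw [slitHit]
    split_ifs
    · exact le_rfl
    · exact zero_le_one
    · refine (latticeMean_le_latticeMean (w := fun _ => 1) fun q _ => ih q).trans ?_
      norm_num [latticeMean]

lemma slitHit_le_succ (n : ℕ) (p : ℤ × ℤ) : slitHit n p ≤ slitHit (n + 1) p := by
  induction n generalizing p with
  | zero =>
    by_cases hp : p = 0
    · simp [slitHit, hp]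
    · rw [slitHit, if_neg hp]
      exact slitHit_nonneg 1 p
  | succ n ih =>
    rw [slitHit, slitHit]
    split_ifs
    · exact le_rfl
    · exact le_rfl
    · exact latticeMean_le_latticeMean fun q _ => ih q

lemma bddAbove_slitHit (p : ℤ × ℤ) : BddAbove (Set.range fun n => slitHit n p) :=
  ⟨1, by rintro _ ⟨n, rfl⟩; exact slitHit_le_one n p⟩

lemma slitHit_le_slitHitLim (n : ℕ) (p : ℤ × ℤ) : slitHit n p ≤ slitHitLim p :=
  le_ciSup (bddAbove_slitHit p) n

lemma tendsto_slitHit (p : ℤ × ℤ) :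
    Filter.Tendsto (fun n => slitHit n p) Filter.atTop (nhds (slitHitLim p)) :=
  tendsto_atTop_ciSup (monotone_nat_of_le_succ fun n => slitHit_le_succ n p) (bddAbove_slitHit p)

lemma slitHitLim_nonneg (p : ℤ × ℤ) : 0 ≤ slitHitLim p :=
  (slitHit_nonneg 0 p).trans (slitHit_le_slitHitLim 0 p)

lemma slitHitLim_zero_pos : 0 < slitHitLim 0 := by
  have := slitHit_le_slitHitLim 0 0
  simp only [slitHit, if_true] at this
  linarith

lemma slitHitLim_eq_latticeMean {p : ℤ × ℤ} (hp : ¬ OnSlit p) :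
    slitHitLim p = latticeMean slitHitLim p := by
  refine tendsto_nhds_unique ((Filter.tendsto_add_atTop_iff_nat 1).2 (tendsto_slitHit p)) ?_
  simp only [slitHit, if_neg (not_onSlit_ne_zero hp), if_neg hp, latticeMean]
  exact ((((tendsto_slitHit _).add (tendsto_slitHit _)).add (tendsto_slitHit _)).add
    (tendsto_slitHit _)).div_const 4

lemma slitHitLim_pos_of_neighbor {p : ℤ × ℤ} (hp : ¬ OnSlit p)
    (h : 0 < slitHitLim (p.1 + 1, p.2) ∨ 0 < slitHitLim (p.1 - 1, p.2) ∨
      0 < slitHitLim (p.1, p.2 + 1) ∨ 0 < slitHitLim (p.1, p.2 - 1)) : 0 < slitHitLim p := by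
  rw [slitHitLim_eq_latticeMean hp, latticeMean]
  have := slitHitLim_nonneg (p.1 + 1, p.2)
  have := slitHitLim_nonneg (p.1 - 1, p.2)
  have := slitHitLim_nonneg (p.1, p.2 + 1)
  have := slitHitLim_nonneg (p.1, p.2 - 1)
  rcases h with h | h | h | h <;> linarith

lemma slitHitLim_pos {p : ℤ × ℤ} (hp : ¬ OnSlit p) : 0 < slitHitLim p := by
  have axis : ∀ n : ℕ, 0 < slitHitLim ((n : ℤ), 0) := by
    intro n
    induction n with
    | zero => exact slitHitLim_zero_pos
    | succ n ih =>
      refine slitHitLim_pos_of_neighbor (fun h => ?_) (Or.inr (Or.inl ?_))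
      · have := h.2
        push_cast at this
        omega
      · simpa using ih
  have right : ∀ x : ℤ, 0 < x → ∀ n : ℕ,
      0 < slitHitLim (x, (n : ℤ)) ∧ 0 < slitHitLim (x, -(n : ℤ)) := by
    intro x hx n
    induction n with
    | zero =>
      lift x to ℕ using hx.le
      simpa using axis x
    | succ n ih =>
      constructor
      · refine slitHitLim_pos_of_neighbor (fun h => absurd h.2 (not_le.2 hx))
          (Or.inr (Or.inr (Or.inr ?_)))
        simpa using ih.1
      · refine slitHitLim_pos_of_neighbor (fun h => absurd h.2 (not_le.2 hx))
          (Or.inr (Or.inr (Or.inl ?_)))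
        simpa using ih.2
  have right' : ∀ x : ℤ, 0 < x → ∀ y : ℤ, 0 < slitHitLim (x, y) := by
    intro x hx y
    obtain ⟨n, rfl | rfl⟩ := y.eq_nat_or_neg
    exacts [(right x hx n).1, (right x hx n).2]
  have left : ∀ y : ℤ, y ≠ 0 → ∀ (n : ℕ) (x : ℤ), 0 < x + n → 0 < slitHitLim (x, y) := by
    intro y hy n
    induction n with
    | zero => exact fun x hx => right' x (by simpa using hx) y
    | succ n ih =>
      intro x hx
      refine slitHitLim_pos_of_neighbor (fun h => hy h.1) (Or.inl (ih (x + 1) ?_))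
      push_cast at hx
      omega
  obtain ⟨x, y⟩ := p
  by_cases hy : y = 0
  · exact right' x (by by_contra! h; exact hp ⟨hy, h⟩) y
  · exact left y hy (x.natAbs + 1) x (by omega)

lemma finite_polarR_le (K : ℝ) : {p : ℤ × ℤ | polarR p ≤ K}.Finite := by
  refine ((Set.finite_Icc (-⌈K⌉) ⌈K⌉).prod (Set.finite_Icc (-⌈K⌉) ⌈K⌉)).subset ?_
  intro p hp
  have hK : polarR p ≤ ⌈K⌉ := le_trans hp (Int.le_ceil K)
  have h1 := (abs_fst_le_polarR p).trans hK
  have h2 := (abs_snd_le_polarR p).trans hK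
  rw [← Int.cast_abs, Int.cast_le, abs_le] at h1 h2
  exact ⟨h1, h2⟩

lemma exists_pos_le_of_not_onSlit {u : ℤ × ℤ → ℝ} (hu : ∀ p, ¬ OnSlit p → 0 < u p) (K : ℝ) :
    ∃ m, 0 < m ∧ ∀ p, ¬ OnSlit p → polarR p ≤ K → m ≤ u p := by
  have hfin : {p : ℤ × ℤ | polarR p ≤ K ∧ ¬ OnSlit p}.Finite :=
    (finite_polarR_le K).subset fun p hp => hp.1
  rcases Set.eq_empty_or_nonempty {p : ℤ × ℤ | polarR p ≤ K ∧ ¬ OnSlit p} with h | h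
  · refine ⟨1, one_pos, fun p hp hK => ?_⟩
    have : p ∈ {p : ℤ × ℤ | polarR p ≤ K ∧ ¬ OnSlit p} := ⟨hK, hp⟩
    simp [h] at this
  · obtain ⟨q, hq, hmin⟩ := Set.exists_min_image _ u hfin h
    exact ⟨u q, hu q hq.2, fun p hp hK => hmin p ⟨hK, hp⟩⟩

lemma slitFun_le_half {p : ℤ × ℤ} (hr : 4 ≤ polarR p) : slitFun p ≤ 1 / 2 := by
  refine (slitFun_le_inv_sqrt p).trans ?_
  rw [one_div]
  refine inv_anti₀ two_pos (Real.le_sqrt_of_sq_le ?_)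
  linarith

lemma exists_slitHitLim_le :
    ∃ C, 0 < C ∧ ∀ p, 160001 ≤ polarR p → slitHitLim p ≤ C * slitFun p := by
  obtain ⟨m, hm, hmin⟩ :=
    exists_pos_le_of_not_onSlit (fun _ => slitFun_pos_of_not_onSlit) 160001
  have hnn : ∀ p, 160000 < polarR p → slitFun p / 2 ≤ slitFun p - slitFun p ^ 2 := by
    intro p hp
    have h1 := slitFun_le_half (p := p) (by linarith)
    nlinarith [slitFun_nonneg p]
  have key : ∀ (n : ℕ) (p : ℤ × ℤ), 160000 < polarR p →
      slitHit n p ≤ 2 / m * (slitFun p - slitFun p ^ 2) := by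
    intro n
    induction n with
    | zero =>
      intro p hp
      have h0 : p ≠ 0 := by
        rintro rfl
        norm_num [polarR] at hp
      rw [slitHit, if_neg h0]
      have := hnn p hp
      have := slitFun_nonneg p
      exact mul_nonneg (by positivity) (by linarith)
    | succ n ih =>
      intro p hp
      have h0 : p ≠ 0 := by
        rintro rfl
        norm_num [polarR] at hp
      by_cases hs : OnSlit p
      · rw [slitHit, if_neg h0, if_pos hs, slitFun_eq_zero_of_onSlit hs]
        simp
      by_cases hR : polarR p ≤ 160001
      · refine (slitHit_le_one _ _).trans ?_
        have h1 := hmin p hs hR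
        have h2 := hnn p hp
        rw [div_mul_eq_mul_div, one_le_div₀ hm]
        linarith
      · rw [slitHit, if_neg h0, if_neg hs]
        refine (latticeMean_le_latticeMean fun q hq => ih q ?_).trans ?_
        · have := (abs_le.1 hq).1
          linarith
        · rw [latticeMean_const_mul]
          have := (latticeMean_slitFun hs hp.le).1
          gcongr
  refine ⟨2 / m, by positivity, fun p hp => ciSup_le fun n => ?_⟩
  refine (key n p (by linarith)).trans ?_
  gcongr
  nlinarith [slitFun_nonneg p]

lemma exists_le_slitHitLim :
    ∃ c, 0 < c ∧ ∀ p, 160001 ≤ polarR p → c * slitFun p ≤ slitHitLim p := by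
  obtain ⟨m, hm, hmin⟩ := exists_pos_le_of_not_onSlit (fun _ => slitHitLim_pos) 160001
  set D : ℤ × ℤ → ℝ := fun q => m / 2 * (slitFun q + slitFun q ^ 2) with hD
  have hDle : ∀ q, 160000 < polarR q → D q ≤ m * slitFun q := by
    intro q hq
    have h1 := slitFun_le_half (p := q) (by linarith)
    have h2 : slitFun q + slitFun q ^ 2 ≤ 2 * slitFun q := by nlinarith [slitFun_nonneg q]
    calc D q ≤ m / 2 * (2 * slitFun q) := by simp only [hD]; gcongr
      _ = m * slitFun q := by ring
  suffices key : ∀ p, 160000 < polarR p → D p ≤ slitHitLim p by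
    refine ⟨m / 2, by positivity, fun p hp => le_trans ?_ (key p (by linarith))⟩
    simp only [hD]
    gcongr
    nlinarith [sq_nonneg (slitFun p)]
  by_contra! hcon
  obtain ⟨p₀, hp₀, hlt⟩ := hcon
  set ε := D p₀ - slitHitLim p₀ with hε
  have hεpos : 0 < ε := by rw [hε]; linarith
  set S : Set (ℤ × ℤ) := {p | 160000 < polarR p ∧ ε ≤ D p - slitHitLim p} with hS
  have hfin : S.Finite := by
    refine (finite_polarR_le ((m / ε) ^ 2)).subset fun p hp => ?_
    have hr : 0 < polarR p := by linarith [hp.1]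
    have h1 : ε ≤ m * (Real.sqrt (polarR p))⁻¹ := by
      calc ε ≤ D p := by linarith [hp.2, slitHitLim_nonneg p]
        _ ≤ m * slitFun p := hDle p hp.1
        _ ≤ _ := by gcongr; exact slitFun_le_inv_sqrt p
    have h2 : Real.sqrt (polarR p) ≤ m / ε := by
      rw [← div_eq_mul_inv, le_div_iff₀ (Real.sqrt_pos.2 hr)] at h1
      rw [le_div_iff₀ hεpos]
      linarith
    exact (Real.sqrt_le_left (by positivity)).1 h2
  obtain ⟨p, hp, hmax⟩ :=
    Set.exists_max_image S (fun q => D q - slitHitLim q) hfin ⟨p₀, hp₀, le_rfl⟩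
  have hs : ¬ OnSlit p := by
    intro hs
    have h1 := hp.2
    have h2 : D p = 0 := by simp [hD, slitFun_eq_zero_of_onSlit hs]
    linarith [slitHitLim_nonneg p]
  by_cases hR : polarR p ≤ 160001
  · have h1 := hmin p hs hR
    have h2 := hDle p hp.1
    have h3 := slitFun_le_half (p := p) (by linarith [hp.1])
    have h4 := hp.2
    nlinarith
  · have h1 : latticeMean D p ≤
        latticeMean (fun q => slitHitLim q + (D p - slitHitLim p)) p := by
      refine latticeMean_le_latticeMean fun q hq => ?_
      have hq' : 160000 < polarR q := by
        have := (abs_le.1 hq).1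
        linarith
      by_cases hqS : q ∈ S
      · have := hmax q hqS
        linarith
      · have h2 : D q - slitHitLim q < ε := by
          by_contra! h
          exact hqS ⟨hq', h⟩
        linarith [hp.2]
    rw [latticeMean_add_const, ← slitHitLim_eq_latticeMean hs, hD, latticeMean_const_mul] at h1
    have h2 := (latticeMean_slitFun hs hp.1.le).2
    have h3 : m / 2 * (slitFun p + slitFun p ^ 2) <
        m / 2 * latticeMean (fun q => slitFun q + slitFun q ^ 2) p := by gcongr
    simp only at h1
    linarith

lemma slitFun_bounds_of_nonneg {p : ℤ × ℤ} (hr : 0 < polarR p) (hx : 0 ≤ p.1) :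
    1 / 2 / Real.sqrt (polarR p) ≤ slitFun p ∧ slitFun p ≤ 1 / Real.sqrt (polarR p) := by
  refine ⟨(sq_le_sq₀ (by positivity) (slitFun_nonneg p)).1 ?_, ?_⟩
  · have hx' : (0 : ℝ) ≤ p.1 := by exact_mod_cast hx
    rw [slitFun_sq, div_pow, Real.sq_sqrt hr.le, div_le_div_iff₀ hr (by positivity)]
    nlinarith [mul_nonneg hr.le hx', mul_pos hr hr]
  · rw [one_div]
    exact slitFun_le_inv_sqrt p

lemma slitFun_bounds_of_nonpos {p : ℤ × ℤ} (hr : 0 < polarR p) (hx : p.1 ≤ 0) :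
    1 / 2 * |(p.2 : ℝ)| / polarR p ^ ((3 : ℝ) / 2) ≤ slitFun p ∧
      slitFun p ≤ |(p.2 : ℝ)| / polarR p ^ ((3 : ℝ) / 2) := by
  have hx' : (p.1 : ℝ) ≤ 0 := by exact_mod_cast hx
  have hpow : (polarR p ^ ((3 : ℝ) / 2)) ^ 2 = polarR p ^ 3 := by
    rw [← Real.rpow_natCast, ← Real.rpow_mul hr.le, ← Real.rpow_natCast]
    norm_num
  have h2 := polarR_sq p
  have hy : (p.2 : ℝ) ^ 2 = (polarR p + p.1) * (polarR p - p.1) := by linarith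
  have h3 := polarR_add_fst_nonneg p
  have h4 : 0 ≤ (polarR p + p.1) * polarR p := by positivity
  have hsq : slitFun p ^ 2 = (polarR p + p.1) * polarR p / 2 / polarR p ^ 3 := by
    rw [slitFun_sq]
    field_simp
  constructor
  · refine (sq_le_sq₀ (by positivity) (slitFun_nonneg p)).1 ?_
    rw [div_pow, mul_pow, sq_abs, hpow, hsq, hy]
    gcongr
    nlinarith
  · refine (sq_le_sq₀ (slitFun_nonneg p) (by positivity)).1 ?_
    rw [div_pow, sq_abs, hpow, hsq, hy]
    gcongr
    nlinarith

/-- The event that `v` is visited during the `n` steps after time `k`, before any point to the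
right of `v` on the same horizontal line is visited after time `k`. -/
def tanWindow {Ω : Type*} (X : ℕ → Ω → ℤ × ℤ) (v : ℤ × ℤ) (k n : ℕ) : Set Ω :=
  {ω | ∃ j ≤ n, X (k + j) ω = v ∧ ∀ i < j, ¬((X (k + i) ω).2 = v.2 ∧ v.1 < (X (k + i) ω).1)}

lemma mem_tanWindow_succ_iff {Ω : Type*} {X : ℕ → Ω → ℤ × ℤ} {v : ℤ × ℤ} {k n : ℕ} {ω : Ω}
    (hv : X k ω ≠ v) : ω ∈ tanWindow X v k (n + 1) ↔
      ¬((X k ω).2 = v.2 ∧ v.1 < (X k ω).1) ∧ ω ∈ tanWindow X v (k + 1) n := by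
  constructor
  · rintro ⟨j, hj, hXj, hpre⟩
    cases j with
    | zero => exact absurd hXj hv
    | succ j =>
      refine ⟨hpre 0 j.succ_pos, j, by omega, ?_, fun i hi => ?_⟩
      · rwa [add_assoc, add_comm 1 j]
      · rw [add_assoc, add_comm 1 i]
        exact hpre (i + 1) (by omega)
  · rintro ⟨h0, j, hj, hXj, hpre⟩
    refine ⟨j + 1, by omega, ?_, fun i hi => ?_⟩
    · rwa [add_comm j 1, ← add_assoc]
    · cases i with
      | zero => exact h0
      | succ i =>
        rw [add_comm i 1, ← add_assoc]
        exact hpre i (by omega)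

lemma ofReal_latticeMean {u : ℤ × ℤ → ℝ} (hu : ∀ q, 0 ≤ u q) (p : ℤ × ℤ) :
    ENNReal.ofReal (latticeMean u p) =
      (ENNReal.ofReal (u (p.1 + 1, p.2)) + ENNReal.ofReal (u (p.1 - 1, p.2)) +
        ENNReal.ofReal (u (p.1, p.2 + 1)) + ENNReal.ofReal (u (p.1, p.2 - 1))) *
          ENNReal.ofReal (1 / 4) := by
  rw [← ENNReal.ofReal_add (hu _) (hu _), ← ENNReal.ofReal_add (add_nonneg (hu _) (hu _)) (hu _),
    ← ENNReal.ofReal_add (add_nonneg (add_nonneg (hu _) (hu _)) (hu _)) (hu _),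
    ← ENNReal.ofReal_mul]
  · simp only [latticeMean]
    congr 1
    ring
  · have := hu (p.1 + 1, p.2)
    have := hu (p.1 - 1, p.2)
    have := hu (p.1, p.2 + 1)
    have := hu (p.1, p.2 - 1)
    positivity

lemma erw2StepProb_zero_eq_zero {first : Prop} {s : ℤ × ℤ}
    (hs : s ∉ ({(1, 0), (-1, 0), (0, 1), (0, -1)} : Finset (ℤ × ℤ))) :
    erw2StepProb 0 first s = 0 := by
  simp only [Finset.mem_insert, Finset.mem_singleton, not_or] at hs
  obtain ⟨h₁, h₂, h₃, h₄⟩ := hs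
  simp [erw2StepProb, h₁, h₂, h₃, h₄]

lemma erw2StepProb_zero_eq_quarter {first : Prop} {s : ℤ × ℤ}
    (hs : s ∈ ({(1, 0), (-1, 0), (0, 1), (0, -1)} : Finset (ℤ × ℤ))) :
    erw2StepProb 0 first s = 1 / 4 := by
  simp only [Finset.mem_insert, Finset.mem_singleton] at hs
  rcases hs with rfl | rfl | rfl | rfl <;> simp [erw2StepProb]

lemma IsERW2.measure_cylinder_inter_tanWindow {Ω : Type*} [MeasurableSpace Ω] {P : Measure Ω}
    {X : ℕ → Ω → ℤ × ℤ} {x₀ : ℤ × ℤ} (hX : IsSRW2 x₀ P X) (v : ℤ × ℤ) (n k : ℕ)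
    (h : ℕ → ℤ × ℤ) :
    P ({ω | ∀ i ≤ k, X i ω = h i} ∩ tanWindow X v k n) =
      ENNReal.ofReal (slitHit n (v - h k)) * P {ω | ∀ i ≤ k, X i ω = h i} := by
  have htip : ∀ (n k : ℕ) (h : ℕ → ℤ × ℤ), h k = v →
      P ({ω | ∀ i ≤ k, X i ω = h i} ∩ tanWindow X v k n) =
        ENNReal.ofReal (slitHit n (v - h k)) * P {ω | ∀ i ≤ k, X i ω = h i} := by
    intro n k h hv
    have hone : slitHit n (v - h k) = 1 := by
      cases n <;> simp [slitHit, hv]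
    rw [hone, ENNReal.ofReal_one, one_mul, Set.inter_eq_left.2]
    exact fun ω hω => ⟨0, n.zero_le, by rw [add_zero, hω k le_rfl, hv], by simp⟩
  induction n generalizing k h with
  | zero =>
    by_cases hv : h k = v
    · exact htip 0 k h hv
    have hv' : v - h k ≠ 0 := fun h0 => hv (sub_eq_zero.1 h0).symm
    have hempty : {ω | ∀ i ≤ k, X i ω = h i} ∩ tanWindow X v k 0 = ∅ := by
      rw [Set.eq_empty_iff_forall_notMem]
      rintro ω ⟨hω, j, hj, hXj, -⟩
      obtain rfl : j = 0 := by omega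
      exact hv (by rw [← hω k le_rfl, ← hXj, add_zero])
    simp [hempty, slitHit, hv']
  | succ n ih =>
    by_cases hv : h k = v
    · exact htip (n + 1) k h hv
    have hv' : v - h k ≠ 0 := fun h0 => hv (sub_eq_zero.1 h0).symm
    have hcyl : ∀ ω ∈ {ω | ∀ i ≤ k, X i ω = h i}, X k ω = h k := fun ω hω => hω k le_rfl
    by_cases hs : OnSlit (v - h k)
    · have hempty : {ω | ∀ i ≤ k, X i ω = h i} ∩ tanWindow X v k (n + 1) = ∅ := by
        rw [Set.eq_empty_iff_forall_notMem]
        rintro ω ⟨hω, hT⟩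
        rw [mem_tanWindow_succ_iff (by rwa [hcyl ω hω]), hcyl ω hω] at hT
        refine hT.1 ⟨?_, ?_⟩
        · have := hs.1
          simp only [Prod.snd_sub] at this
          omega
        · have h1 := hs.1
          have h2 := hs.2
          simp only [Prod.snd_sub, Prod.fst_sub] at h1 h2
          refine (show v.1 ≤ (h k).1 by omega).lt_of_ne fun h3 => hv ?_
          exact Prod.ext h3.symm (by omega)
      simp [hempty, slitHit, hv', hs]
    set A := {ω | ∀ i ≤ k, X i ω = h i} with hA
    have hshift : A ∩ tanWindow X v k (n + 1) = A ∩ tanWindow X v (k + 1) n := by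
      ext ω
      refine and_congr_right fun hω => ?_
      rw [mem_tanWindow_succ_iff (by rwa [hcyl ω hω]), hcyl ω hω]
      refine and_iff_right ?_
      rintro ⟨h1, h2⟩
      refine hs ⟨?_, ?_⟩
      · simp only [Prod.snd_sub]
        omega
      · simp only [Prod.fst_sub]
        omega
    have hfiber : ∀ s : ℤ × ℤ,
        P ((fun ω => X (k + 1) ω - h k) ⁻¹' {s} ∩ (A ∩ tanWindow X v (k + 1) n)) =
          ENNReal.ofReal (slitHit n (v - h k - s)) *
            (ENNReal.ofReal (erw2StepProb 0 (∀ i < k, h i ≠ h k) s) * P A) := by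
      intro s
      set h' := Function.update h (k + 1) (h k + s) with hh'
      have hcyl' : {ω | ∀ i ≤ k + 1, X i ω = h' i} = {ω | X (k + 1) ω = h k + s} ∩ A := by
        ext ω
        have hlow : ∀ i ≤ k, h' i = h i := fun i hi =>
          Function.update_of_ne (by omega) _ _
        constructor
        · intro hω
          refine ⟨?_, fun i hi => ?_⟩
          · have := hω (k + 1) le_rfl
            rwa [hh', Function.update_self] at this
          · rw [← hlow i hi]
            exact hω i (by omega)
        · rintro ⟨h1, h2⟩ i hi
          rcases hi.lt_or_eq with hi | rfl
          · rw [hlow i (by omega)]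
            exact h2 i (by omega)
          · rw [hh', Function.update_self]
            exact h1
      have hset : (fun ω => X (k + 1) ω - h k) ⁻¹' {s} ∩ (A ∩ tanWindow X v (k + 1) n) =
          {ω | ∀ i ≤ k + 1, X i ω = h' i} ∩ tanWindow X v (k + 1) n := by
        rw [hcyl', Set.inter_assoc]
        congr 1
        ext ω
        simp [sub_eq_iff_eq_add, add_comm]
      rw [hset, ih (k + 1) h', hcyl', hX.step k h s]
      rw [hh', Function.update_self, sub_add_eq_sub_sub]
    have hmeas : Measurable fun ω => X (k + 1) ω - h k :=
      (Measurable.of_discrete (f := fun q : ℤ × ℤ => q - h k)).comp (hX.meas (k + 1))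
    have hsum := tsum_measure_preimage_singleton (μ := P.restrict (A ∩ tanWindow X v (k + 1) n))
      Set.countable_univ (f := fun ω => X (k + 1) ω - h k)
      fun s _ => hmeas (measurableSet_singleton s)
    rw [tsum_univ (fun s => P.restrict (A ∩ tanWindow X v (k + 1) n)
      ((fun ω => X (k + 1) ω - h k) ⁻¹' {s})), Set.preimage_univ, Measure.restrict_apply_univ]
      at hsum
    rw [hshift, ← hsum]
    simp_rw [Measure.restrict_apply (hmeas (measurableSet_singleton _)), hfiber]
    rw [tsum_eq_sum (s := {(1, 0), (-1, 0), (0, 1), (0, -1)}) fun s hs => by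
      rw [erw2StepProb_zero_eq_zero hs, ENNReal.ofReal_zero, zero_mul, mul_zero]]
    rw [Finset.sum_congr rfl fun s hs => by rw [erw2StepProb_zero_eq_quarter hs],
      ← Finset.sum_mul, ← mul_assoc]
    congr 1
    rw [slitHit, if_neg hv', if_neg hs, ofReal_latticeMean (slitHit_nonneg n)]
    congr 1
    rw [Finset.sum_insert (by decide), Finset.sum_insert (by decide),
      Finset.sum_insert (by decide), Finset.sum_singleton]
    have e₁ : v - h k - (1, 0) = ((v - h k).1 - 1, (v - h k).2) := by ext <;> simp
    have e₂ : v - h k - (-1, 0) = ((v - h k).1 + 1, (v - h k).2) := by ext <;> simp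
    have e₃ : v - h k - (0, 1) = ((v - h k).1, (v - h k).2 - 1) := by ext <;> simp
    have e₄ : v - h k - (0, -1) = ((v - h k).1, (v - h k).2 + 1) := by ext <;> simp
    rw [e₁, e₂, e₃, e₄]
    ring

lemma IsERW2.toReal_measure_isTanPoint {Ω : Type*} [MeasurableSpace Ω] {P : Measure Ω}
    {X : ℕ → Ω → ℤ × ℤ} (hX : IsSRW2 (0, 0) P X) (v : ℤ × ℤ) :
    (P {ω | IsTanPoint X ω v}).toReal = slitHitLim v := by
  have := hX.isProb
  have hwin : ∀ n, P (tanWindow X v 0 n) = ENNReal.ofReal (slitHit n v) := by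
    intro n
    have hae : {ω | ∀ i ≤ 0, X i ω = (0, 0)} =ᵐ[P] Set.univ := by
      refine Filter.eventuallyEq_set.2 (hX.start.mono fun ω hω => ?_)
      simp [hω]
    have hae' : ({ω | ∀ i ≤ 0, X i ω = (0, 0)} ∩ tanWindow X v 0 n : Set Ω) =ᵐ[P]
        tanWindow X v 0 n := by
      refine Filter.eventuallyEq_set.2 (hX.start.mono fun ω hω => ?_)
      simp [hω]
    have h1 := hX.measure_cylinder_inter_tanWindow v n 0 fun _ => (0, 0)
    rw [measure_congr hae, measure_univ, mul_one, measure_congr hae'] at h1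
    rw [h1]
    congr 2
    exact sub_zero v
  have hunion : {ω | IsTanPoint X ω v} = ⋃ n, tanWindow X v 0 n := by
    ext ω
    simp only [Set.mem_iUnion, tanWindow, Set.mem_ofPred_eq, zero_add]
    exact ⟨fun ⟨n, hn⟩ => ⟨n, n, le_rfl, hn⟩, fun ⟨_, j, _, hj⟩ => ⟨j, hj⟩⟩
  have hmono : Monotone fun n => tanWindow X v 0 n := by
    rintro m n hmn ω ⟨j, hj, h⟩
    exact ⟨j, hj.trans hmn, h⟩
  have hlim := tendsto_measure_iUnion_atTop (μ := P) hmono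
  rw [← hunion] at hlim
  refine tendsto_nhds_unique ((ENNReal.tendsto_toReal (measure_ne_top P _)).comp hlim) ?_
  refine (tendsto_slitHit v).congr fun n => ?_
  simp only [Function.comp_apply, hwin, ENNReal.toReal_ofReal (slitHit_nonneg n v)]

/-- **Crude tan point probability bounds.** There are constants `c, C, r₀ > 0`
such that for every lattice point `v = (x,y)` with polar radius `r ≥ r₀`, the
probability `q(v)` that `v` is a tan point for simple random walk started at the
origin satisfies `c·r^{-1/2} ≤ q(v) ≤ C·r^{-1/2}` when `x ≥ 0`, and
`c·|y|·r^{-3/2} ≤ q(v) ≤ C·|y|·r^{-3/2}` when `x ≤ 0`. -/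
theorem tan_point_probability_crude_bounds
    {Ω : Type*} [MeasurableSpace Ω] (P : Measure Ω)
    (X : ℕ → Ω → ℤ × ℤ) (hX : IsSRW2 (0, 0) P X) :
    ∃ c C r₀ : ℝ, 0 < c ∧ 0 < C ∧ 0 < r₀ ∧
      ∀ v : ℤ × ℤ, r₀ ≤ polarR v →
        (0 ≤ v.1 →
          c / Real.sqrt (polarR v) ≤ (P {ω | IsTanPoint X ω v}).toReal ∧
            (P {ω | IsTanPoint X ω v}).toReal ≤ C / Real.sqrt (polarR v)) ∧
        (v.1 ≤ 0 →
          c * |(v.2 : ℝ)| / polarR v ^ ((3 : ℝ) / 2) ≤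
              (P {ω | IsTanPoint X ω v}).toReal ∧
            (P {ω | IsTanPoint X ω v}).toReal ≤
              C * |(v.2 : ℝ)| / polarR v ^ ((3 : ℝ) / 2)) := by
  obtain ⟨c, hc, hlow⟩ := exists_le_slitHitLim
  obtain ⟨C, hC, hupp⟩ := exists_slitHitLim_le
  refine ⟨c / 2, C, 160001, by positivity, hC, by norm_num, fun v hv => ?_⟩
  rw [hX.toReal_measure_isTanPoint v]
  have hr : 0 < polarR v := by linarith
  have hl := hlow v hv
  have hu := hupp v hv
  refine ⟨fun hx => ?_, fun hx => ?_⟩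
  · obtain ⟨h1, h2⟩ := slitFun_bounds_of_nonneg hr hx
    constructor
    · calc c / 2 / Real.sqrt (polarR v) = c * (1 / 2 / Real.sqrt (polarR v)) := by ring
        _ ≤ c * slitFun v := by gcongr
        _ ≤ _ := hl
    · calc slitHitLim v ≤ C * slitFun v := hu
        _ ≤ C * (1 / Real.sqrt (polarR v)) := by gcongr
        _ = C / Real.sqrt (polarR v) := by ring
  · obtain ⟨h1, h2⟩ := slitFun_bounds_of_nonpos hr hx
    constructor
    · calc c / 2 * |(v.2 : ℝ)| / polarR v ^ ((3 : ℝ) / 2) =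
            c * (1 / 2 * |(v.2 : ℝ)| / polarR v ^ ((3 : ℝ) / 2)) := by ring
        _ ≤ c * slitFun v := by gcongr
        _ ≤ _ := hl
    · calc slitHitLim v ≤ C * slitFun v := hu
        _ ≤ C * (|(v.2 : ℝ)| / polarR v ^ ((3 : ℝ) / 2)) := by gcongr
        _ = C * |(v.2 : ℝ)| / polarR v ^ ((3 : ℝ) / 2) := by ring
end
end

section
/- There is a coupling of the excited random walk on Z^2 with bias ε/2 and the simple random walk on Z^2, both started at the origin, such that at every time n the y-coordinates of the two walks are equal, and such that whenever the simple random walk is at a tan point that it is visiting for the first time, the excited random walk is at a vertex it has never visited before. Consequently, under this coupling the number of distinct vertices visited by the ERW up to time n is at least the number of tan points visited by the SRW up to time n. -/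
open MeasureTheory
open scoped Classical

noncomputable section

/-- The elementary moves driving the coupled walks: the simple random walk moves left on `flip`,
while the excited walk moves right on `flip` at a first visit and left otherwise. -/
inductive CoupledMove
  | right
  | up
  | down
  | left
  | flip

namespace CoupledMove

instance : Finite CoupledMove :=
  .of_surjective (![right, up, down, left, flip] : Fin 5 → CoupledMove) fun a => by
    cases a
    exacts [⟨0, rfl⟩, ⟨1, rfl⟩, ⟨2, rfl⟩, ⟨3, rfl⟩, ⟨4, rfl⟩]

instance : MeasurableSpace CoupledMove := ⊤

instance : DiscreteMeasurableSpace CoupledMove := ⟨fun _ => trivial⟩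

/-- The displacement of a walker performing a move; `excited` tells whether `flip` is reversed. -/
def step (excited : Prop) : CoupledMove → ℤ × ℤ
  | right => (1, 0)
  | up => (0, 1)
  | down => (0, -1)
  | left => (-1, 0)
  | flip => if excited then (1, 0) else (-1, 0)

/-- The law of a single move: `flip` has probability `ε/4` and `left` has `(1-ε)/4`. -/
def law (ε : ℝ) : Measure CoupledMove :=
  ENNReal.ofReal (1 / 4) • Measure.dirac right + ENNReal.ofReal (1 / 4) • Measure.dirac up +
    ENNReal.ofReal (1 / 4) • Measure.dirac down +
    ENNReal.ofReal ((1 - ε) / 4) • Measure.dirac left + ENNReal.ofReal (ε / 4) • Measure.dirac flip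

lemma isProbabilityMeasure_law {ε : ℝ} (h0 : 0 ≤ ε) (h1 : ε ≤ 1) :
    IsProbabilityMeasure (law ε) := by
  have h1' : 0 ≤ (1 - ε) / 4 := by linarith
  have h0' : 0 ≤ ε / 4 := by linarith
  constructor
  simp only [law, Measure.add_apply, Measure.smul_apply, measure_univ, smul_eq_mul, mul_one]
  rw [← ENNReal.ofReal_add (by positivity) (by positivity),
    ← ENNReal.ofReal_add (by positivity) (by positivity),
    ← ENNReal.ofReal_add (by positivity) h1', ← ENNReal.ofReal_add (by positivity) h0',
    ← ENNReal.ofReal_one]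
  congr 1
  ring

lemma law_apply (ε : ℝ) (s : Set CoupledMove) :
    law ε s = (if right ∈ s then ENNReal.ofReal (1 / 4) else 0) +
      (if up ∈ s then ENNReal.ofReal (1 / 4) else 0) +
      (if down ∈ s then ENNReal.ofReal (1 / 4) else 0) +
      (if left ∈ s then ENNReal.ofReal ((1 - ε) / 4) else 0) +
      (if flip ∈ s then ENNReal.ofReal (ε / 4) else 0) := by
  simp [law, Set.indicator_apply]

lemma law_step_eq {ε : ℝ} (h0 : 0 ≤ ε) (h1 : ε ≤ 1) (p : Prop) (s : ℤ × ℤ) :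
    law ε {a | step p a = s} = ENNReal.ofReal (erw2StepProb ε p s) := by
  have h1' : 0 ≤ (1 - ε) / 4 := by linarith
  have h0' : 0 ≤ ε / 4 := by linarith
  have hr : ENNReal.ofReal (1 / 4) + ENNReal.ofReal (ε / 4) = ENNReal.ofReal ((1 + ε) / 4) := by
    rw [← ENNReal.ofReal_add (by positivity) h0']
    congr 1
    ring
  have hl : ENNReal.ofReal ((1 - ε) / 4) + ENNReal.ofReal (ε / 4) = ENNReal.ofReal (1 / 4) := by
    rw [← ENNReal.ofReal_add h1' h0']
    congr 1
    ring
  rw [law_apply]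
  simp only [Set.mem_ofPred_eq, step, erw2StepProb]
  by_cases hs1 : s = (1, 0)
  · subst hs1
    by_cases hp : p <;> simp [hp]; simpa using hr
  by_cases hs2 : s = (-1, 0)
  · subst hs2
    by_cases hp : p <;> simp [hp]; simpa using hl
  by_cases hs3 : s = (0, 1)
  · subst hs3
    by_cases hp : p <;> simp [hp]
  by_cases hs4 : s = (0, -1)
  · subst hs4
    by_cases hp : p <;> simp [hp]
  by_cases hp : p <;>
    simp [hp, hs1, hs2, hs3, hs4, Ne.symm hs1, Ne.symm hs2, Ne.symm hs3, Ne.symm hs4]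

lemma step_snd (p q : Prop) (a : CoupledMove) : (step p a).2 = (step q a).2 := by
  cases a <;> simp only [step]
  split_ifs <;> rfl

lemma step_false_fst_le (p : Prop) (a : CoupledMove) : (step False a).1 ≤ (step p a).1 := by
  cases a <;> by_cases hp : p <;> simp [step, hp]

end CoupledMove

open CoupledMove ProbabilityTheory

/-- The position and the set of previously visited vertices of a walk driven by the moves `ω`
that reverses `flip` exactly when `exc` holds and the current vertex is new. -/
def drivenState (exc : Prop) (ω : ℕ → CoupledMove) : ℕ → (ℤ × ℤ) × Set (ℤ × ℤ)
  | 0 => ((0, 0), ∅)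
  | n + 1 =>
    let x := drivenState exc ω n
    (x.1 + step (exc ∧ x.1 ∉ x.2) (ω n), insert x.1 x.2)

/-- The walk driven by the moves `ω` that reverses `flip` exactly at first visits if `exc` holds,
and never otherwise. -/
def drivenWalk (exc : Prop) (n : ℕ) (ω : ℕ → CoupledMove) : ℤ × ℤ := (drivenState exc ω n).1

lemma drivenState_snd (exc : Prop) (ω : ℕ → CoupledMove) (n : ℕ) :
    (drivenState exc ω n).2 = {v | ∃ k < n, drivenWalk exc k ω = v} := by
  induction n with
  | zero => simp [drivenState]
  | succ n ih =>
    ext v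
    simp only [drivenState, ih, Set.mem_insert_iff, Set.mem_ofPred_eq, Nat.lt_succ_iff_lt_or_eq,
      or_and_right, exists_or, exists_eq_left]
    rw [or_comm, eq_comm (a := v)]
    rfl

lemma drivenWalk_succ (exc : Prop) (n : ℕ) (ω : ℕ → CoupledMove) :
    drivenWalk exc (n + 1) ω = drivenWalk exc n ω +
      step (exc ∧ ∀ k < n, drivenWalk exc k ω ≠ drivenWalk exc n ω) (ω n) := by
  have h : (drivenState exc ω n).1 ∉ (drivenState exc ω n).2 ↔
      ∀ k < n, drivenWalk exc k ω ≠ drivenWalk exc n ω := by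
    rw [drivenState_snd]
    simp [drivenWalk]
  simp only [drivenWalk, drivenState] at h ⊢
  simp only [h]

lemma drivenState_congr (exc : Prop) {ω ω' : ℕ → CoupledMove} {n : ℕ}
    (h : ∀ k < n, ω k = ω' k) : drivenState exc ω n = drivenState exc ω' n := by
  induction n with
  | zero => rfl
  | succ n ih =>
    simp only [drivenState, ih fun k hk => h k (hk.trans n.lt_succ_self), h n n.lt_succ_self]

/-- The sequence of moves given by finitely many initial moves, continued arbitrarily. -/
def extendMoves (n : ℕ) (a : Finset.range n → CoupledMove) (k : ℕ) : CoupledMove :=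
  if hk : k ∈ Finset.range n then a ⟨k, hk⟩ else right

lemma drivenWalk_extendMoves (exc : Prop) {k n : ℕ} (hk : k ≤ n) (ω : ℕ → CoupledMove) :
    drivenWalk exc k (extendMoves n fun i => ω i) = drivenWalk exc k ω := by
  unfold drivenWalk
  rw [drivenState_congr]
  intro j hj
  simp [extendMoves, hj.trans_le hk]

lemma measurable_drivenWalk (exc : Prop) (n : ℕ) : Measurable (drivenWalk exc n) := by
  have h : drivenWalk exc n = (fun a => drivenWalk exc n (extendMoves n a)) ∘
      fun ω (i : Finset.range n) => ω i := by
    ext1 ω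
    exact (drivenWalk_extendMoves exc le_rfl ω).symm
  rw [h]
  exact (measurable_of_countable _).comp (measurable_pi_lambda _ fun i => measurable_pi_apply _)

lemma infinitePi_inter_history (μ : Measure CoupledMove) [IsProbabilityMeasure μ] (n : ℕ)
    (B : Set CoupledMove) (T : Set (Finset.range n → CoupledMove)) :
    Measure.infinitePi (fun _ : ℕ => μ) ({ω | ω n ∈ B} ∩ {ω | (fun i : Finset.range n => ω i) ∈ T})
      = μ B * Measure.infinitePi (fun _ : ℕ => μ) {ω | (fun i : Finset.range n => ω i) ∈ T} := by
  have hind : iIndepFun (fun i (ω : ℕ → CoupledMove) => ω i)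
      (Measure.infinitePi fun _ : ℕ => μ) :=
    iIndepFun_infinitePi (P := fun _ : ℕ => μ) (X := fun _ => id) fun _ => measurable_id
  have h := (hind.indepFun_finset {n} (Finset.range n) (by simp)
    fun i => measurable_pi_apply i).measure_inter_preimage_eq_mul
    {a | a ⟨n, Finset.mem_singleton_self n⟩ ∈ B} T (Set.to_countable _).measurableSet
    (Set.to_countable _).measurableSet
  have hB : Measure.infinitePi (fun _ : ℕ => μ) {ω | ω n ∈ B} = μ B := by
    rw [← (measurePreserving_eval_infinitePi (fun _ : ℕ => μ) n).measure_preimage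
      (MeasurableSet.of_discrete (s := B)).nullMeasurableSet]
    rfl
  rw [← hB]
  exact h

lemma isERW2_drivenWalk {ε δ : ℝ} (h0 : 0 ≤ ε) (h1 : ε ≤ 1) (exc : Prop)
    (hstep : ∀ (p : Prop) (s : ℤ × ℤ), law ε {a | step (exc ∧ p) a = s} =
      ENNReal.ofReal (erw2StepProb δ p s)) :
    IsERW2 δ (0, 0) (Measure.infinitePi fun _ : ℕ => law ε) (drivenWalk exc) := by
  have := isProbabilityMeasure_law h0 h1
  refine ⟨inferInstance, measurable_drivenWalk exc, .of_forall fun _ => rfl, fun n h s => ?_⟩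
  have hist : {ω | ∀ k ≤ n, drivenWalk exc k ω = h k} =
      {ω : ℕ → CoupledMove | (fun i : Finset.range n => ω i) ∈
        {a | ∀ k ≤ n, drivenWalk exc k (extendMoves n a) = h k}} := by
    ext ω
    exact forall₂_congr fun k hk => by rw [drivenWalk_extendMoves exc hk ω]
  rw [← hstep, hist, ← infinitePi_inter_history, ← hist]
  congr 1
  ext ω
  simp only [Set.mem_inter_iff, Set.mem_ofPred_eq, and_congr_left_iff]
  intro hω
  have hnew : (∀ k < n, drivenWalk exc k ω ≠ drivenWalk exc n ω) ↔ ∀ k < n, h k ≠ h n :=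
    forall₂_congr fun k hk => by rw [hω k hk.le, hω n le_rfl]
  rw [drivenWalk_succ, hnew, hω n le_rfl, add_right_inj]

lemma drivenWalk_snd (p q : Prop) (n : ℕ) (ω : ℕ → CoupledMove) :
    (drivenWalk p n ω).2 = (drivenWalk q n ω).2 := by
  induction n with
  | zero => rfl
  | succ n ih => rw [drivenWalk_succ, drivenWalk_succ, Prod.snd_add, Prod.snd_add, ih, step_snd]

lemma monotone_drivenWalk_fst_sub (exc : Prop) (ω : ℕ → CoupledMove) :
    Monotone fun n => (drivenWalk exc n ω).1 - (drivenWalk False n ω).1 := by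
  refine monotone_nat_of_le_succ fun n => ?_
  have := step_false_fst_le (exc ∧ ∀ k < n, drivenWalk exc k ω ≠ drivenWalk exc n ω) (ω n)
  rw [drivenWalk_succ, drivenWalk_succ, false_and, Prod.fst_add, Prod.fst_add]
  linarith

lemma drivenWalk_ne_of_tan (exc : Prop) (ω : ℕ → CoupledMove) {n : ℕ}
    (hnew : ∀ m < n, drivenWalk False m ω ≠ drivenWalk False n ω)
    (htan : ∀ m < n, ¬((drivenWalk False m ω).2 = (drivenWalk False n ω).2 ∧
      (drivenWalk False n ω).1 < (drivenWalk False m ω).1)) :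
    ∀ m < n, drivenWalk exc m ω ≠ drivenWalk exc n ω := by
  intro m hm heq
  have hy : (drivenWalk False m ω).2 = (drivenWalk False n ω).2 := by
    rw [drivenWalk_snd False exc, drivenWalk_snd False exc, heq]
  have hle : (drivenWalk False m ω).1 ≤ (drivenWalk False n ω).1 :=
    not_lt.mp fun h => htan m hm ⟨hy, h⟩
  have hne : (drivenWalk False m ω).1 ≠ (drivenWalk False n ω).1 :=
    fun h => hnew m hm (Prod.ext h hy)
  have hmono := monotone_drivenWalk_fst_sub exc ω hm.le
  simp only [heq] at hmono
  omega

lemma ncard_tanPointBy_le {Ω : Type*} {S E : ℕ → Ω → ℤ × ℤ} {ω : Ω}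
    (h : ∀ n, ((∀ m < n, S m ω ≠ S n ω) ∧
        ∀ m < n, ¬((S m ω).2 = (S n ω).2 ∧ (S n ω).1 < (S m ω).1)) →
      ∀ m < n, E m ω ≠ E n ω) (n : ℕ) :
    Set.ncard {v : ℤ × ℤ | TanPointBy S ω v (n + 1)} ≤
      Set.ncard {v : ℤ × ℤ | ∃ k ≤ n, E k ω = v} := by
  set K : Set ℕ := {k | k ≤ n ∧ (∀ m < k, S m ω ≠ S k ω) ∧
    ∀ m < k, ¬((S m ω).2 = (S k ω).2 ∧ (S k ω).1 < (S m ω).1)}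
  have hKfin : K.Finite := (Set.finite_Iic n).subset fun k hk => hk.1
  have hsub : {v : ℤ × ℤ | TanPointBy S ω v (n + 1)} ⊆ (fun k => S k ω) '' K := by
    rintro v ⟨k, hk, hkv, htan⟩
    have hex : ∃ j, S j ω = v := ⟨k, hkv⟩
    have hle : Nat.find hex ≤ k := Nat.find_min' hex hkv
    have hv := Nat.find_spec hex
    refine ⟨Nat.find hex, ⟨by omega, fun m hm => ?_, fun m hm => ?_⟩, hv⟩
    · rw [hv]
      exact Nat.find_min hex hm
    · rw [hv]
      exact htan m (hm.trans_le hle)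
  have hinj : Set.InjOn (fun k => E k ω) K := by
    intro a ha b hb hab
    rcases lt_trichotomy a b with hlt | heq | hlt
    · exact absurd hab (h b hb.2 a hlt)
    · exact heq
    · exact absurd hab.symm (h a ha.2 b hlt)
  calc
    _ ≤ ((fun k => S k ω) '' K).ncard := Set.ncard_le_ncard hsub (hKfin.image _)
    _ ≤ K.ncard := Set.ncard_image_le hKfin
    _ = ((fun k => E k ω) '' K).ncard := hinj.ncard_image.symm
    _ ≤ _ := by
      refine Set.ncard_le_ncard ?_ ((Set.finite_Iic n).image fun k => E k ω)
      rintro _ ⟨k, hk, rfl⟩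
      exact ⟨k, hk.1, rfl⟩

lemma erw2StepProb_false (ε : ℝ) (p : Prop) (s : ℤ × ℤ) :
    erw2StepProb ε False s = erw2StepProb 0 p s := by
  simp [erw2StepProb]

/-- **Coupling of excited random walk with simple random walk on `ℤ²`.**
For `0 < ε ≤ 1` there is a coupling `(S, E)` of simple random walk `S` and the
excited random walk `E` with bias `ε/2`, both started at the origin, such that:
the `y`-coordinates of the two walks agree at all times; whenever `S` is at a tan
point that it visits for the first time, `E` is at a vertex it has never visited
before; and consequently the number of distinct vertices visited by `E` up to time
`n` is at least the number of tan points visited by `S` up to time `n`. -/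
theorem erw_srw_coupling (ε : ℝ) (hε0 : 0 < ε) (hε1 : ε ≤ 1) :
    ∃ (Ω : Type) (_ : MeasurableSpace Ω) (P : Measure Ω)
      (S E : ℕ → Ω → ℤ × ℤ),
      IsSRW2 (0, 0) P S ∧ IsERW2 ε (0, 0) P E ∧
      (∀ᵐ ω ∂P, ∀ n, (S n ω).2 = (E n ω).2) ∧
      (∀ᵐ ω ∂P, ∀ n,
        ((∀ m < n, S m ω ≠ S n ω) ∧
            ∀ m < n, ¬((S m ω).2 = (S n ω).2 ∧ (S n ω).1 < (S m ω).1)) →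
          ∀ m < n, E m ω ≠ E n ω) ∧
      (∀ᵐ ω ∂P, ∀ n,
        Set.ncard {v : ℤ × ℤ | TanPointBy S ω v (n + 1)} ≤
          Set.ncard {v : ℤ × ℤ | ∃ k ≤ n, E k ω = v}) := by
  have hgood (ω : ℕ → CoupledMove) (n : ℕ) :
      ((∀ m < n, drivenWalk False m ω ≠ drivenWalk False n ω) ∧
        ∀ m < n, ¬((drivenWalk False m ω).2 = (drivenWalk False n ω).2 ∧
          (drivenWalk False n ω).1 < (drivenWalk False m ω).1)) →
      ∀ m < n, drivenWalk True m ω ≠ drivenWalk True n ω :=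
    fun h => drivenWalk_ne_of_tan True ω h.1 h.2
  refine ⟨ℕ → CoupledMove, inferInstance, Measure.infinitePi fun _ => law ε, drivenWalk False,
    drivenWalk True, isERW2_drivenWalk hε0.le hε1 False fun p s => ?_,
    isERW2_drivenWalk hε0.le hε1 True fun p s => ?_,
    .of_forall fun ω n => drivenWalk_snd False True n ω, .of_forall hgood,
    .of_forall fun ω => ncard_tanPointBy_le (hgood ω)⟩
  · rw [false_and, law_step_eq hε0.le hε1, erw2StepProb_false ε p]
  · rw [true_and, law_step_eq hε0.le hε1]
end
end
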